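/- arXiv:1603.01734 — 3 statements merged into one kernel-verified Lean document; each statement's English description precedes it below -/
import Mathlib

section
/- There exists η_0 > 0 such that for every 0 < η ≤ η_0 there exists a constant C > 0 with the following property. For every δ > 0 there exists n_0 such that for every Abelian group G of order n ≥ n_0, if U is a random subset of G with each element chosen independently with probability C n^{-2/3} (log n)^{1/3}, then with probability at least 1 − δ the following holds: for every finitely generated Abelian group H and every Freiman homomorphism φ : U → H, there exists an affine homomorphism α : G → H such that φ(x) = α(x) for all but at most 80η|U| elements x ∈ U. -/
open scoped Classical
open Finset

noncomputable section

/-- The weight of a particular outcome `A` when each element of a finite type `G`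
is included independently with probability `p`. -/
def bernWeight {G : Type*} [Fintype G] (p : ℝ) (A : Finset G) : ℝ :=
  p ^ A.card * (1 - p) ^ (Fintype.card G - A.card)

/-- The probability that a random subset of `G`, with each element chosen independently
with probability `p`, satisfies the event `E`. -/
def randomSubsetProb (G : Type*) [Fintype G] (p : ℝ) (E : Finset G → Prop) : ℝ :=
  ∑ A : Finset G, if E A then bernWeight p A else 0

/-- `φ` is a Freiman homomorphism on `U`. -/
def FreimanHomOn {G H : Type*} [AddCommGroup G] [AddCommGroup H]
    (U : Finset G) (φ : G → H) : Prop :=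
  ∀ a ∈ U, ∀ b ∈ U, ∀ c ∈ U, ∀ d ∈ U, a + b = c + d → φ a + φ b = φ c + φ d

/-! ### Probability basics -/

/-- Expectation of `f` over a random subset of density `p`. -/
def Ex {G : Type*} [Fintype G] (p : ℝ) (f : Finset G → ℝ) : ℝ :=
  ∑ A : Finset G, bernWeight p A * f A

/-- Real-valued indicator of a proposition. -/
def ind (P : Prop) : ℝ := if P then 1 else 0

lemma ind_nonneg (P : Prop) : 0 ≤ ind P := by unfold ind; split_ifs <;> norm_num
lemma ind_le_one (P : Prop) : ind P ≤ 1 := by unfold ind; split_ifs <;> norm_num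
lemma ind_true {P : Prop} (h : P) : ind P = 1 := by simp [ind, h]
lemma ind_false {P : Prop} (h : ¬ P) : ind P = 0 := by simp [ind, h]
lemma ind_mono {P Q : Prop} (h : P → Q) : ind P ≤ ind Q := by
  by_cases hp : P
  · rw [ind_true hp, ind_true (h hp)]
  · rw [ind_false hp]; exact ind_nonneg _
lemma ind_or {P Q : Prop} : ind (P ∨ Q) ≤ ind P + ind Q := by
  by_cases hp : P <;> by_cases hq : Q <;> simp [ind, hp, hq]

lemma ind_congr {P Q : Prop} (h : P ↔ Q) : ind P = ind Q := by rw [propext h]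

lemma card_filter_ind {α : Type*} (s : Finset α) (P : α → Prop) {_ : DecidablePred P} :
    ((s.filter P).card : ℝ) = ∑ x ∈ s, ind (P x) := by
  rw [Finset.card_filter]
  push_cast
  refine Finset.sum_congr rfl fun x _ => ?_
  by_cases h : P x <;> simp [ind, h]

section Prob
variable {G : Type*} [Fintype G]

lemma sum_prod_ite (s t : G → ℝ) :
    ∑ A : Finset G, ∏ x, (if x ∈ A then s x else t x) = ∏ x, (s x + t x) := by
  rw [Finset.prod_add, Finset.powerset_univ]
  refine Finset.sum_congr rfl fun A _ => ?_
  rw [Finset.prod_ite]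
  congr 1
  · congr 1; ext; simp
  · congr 1; ext; simp

lemma bernWeight_eq (p : ℝ) (A : Finset G) :
    bernWeight p A = ∏ x, (if x ∈ A then p else 1 - p) := by
  rw [Finset.prod_ite, Finset.prod_const, Finset.prod_const]
  unfold bernWeight
  congr 2
  · congr 1; ext; simp
  · rw [← Finset.card_compl]; congr 1; ext; simp

lemma bernWeight_nonneg {p : ℝ} (h0 : 0 ≤ p) (h1 : p ≤ 1) (A : Finset G) :
    0 ≤ bernWeight p A := by
  unfold bernWeight
  have : 0 ≤ 1 - p := by linarith
  positivity

lemma Ex_const (p c : ℝ) : Ex (G := G) p (fun _ => c) = c := by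
  unfold Ex
  rw [← Finset.sum_mul]
  have : ∑ A : Finset G, bernWeight p A = 1 := by
    simp_rw [bernWeight_eq]
    rw [sum_prod_ite]; simp
  rw [this, one_mul]

lemma Ex_mono {p : ℝ} (h0 : 0 ≤ p) (h1 : p ≤ 1) {f g : Finset G → ℝ} (h : ∀ A, f A ≤ g A) :
    Ex p f ≤ Ex p g :=
  Finset.sum_le_sum fun A _ => mul_le_mul_of_nonneg_left (h A) (bernWeight_nonneg h0 h1 A)

lemma Ex_add (p : ℝ) (f g : Finset G → ℝ) : Ex p (fun A => f A + g A) = Ex p f + Ex p g := by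
  simp [Ex, mul_add, Finset.sum_add_distrib]

lemma Ex_mul (p c : ℝ) (f : Finset G → ℝ) : Ex p (fun A => c * f A) = c * Ex p f := by
  unfold Ex; rw [Finset.mul_sum]; exact Finset.sum_congr rfl fun A _ => by ring

lemma Ex_sum {ι : Type*} (s : Finset ι) (p : ℝ) (f : ι → Finset G → ℝ) :
    Ex p (fun A => ∑ i ∈ s, f i A) = ∑ i ∈ s, Ex p (f i) := by
  unfold Ex
  simp_rw [Finset.mul_sum]
  rw [Finset.sum_comm]

lemma Ex_nonneg {p : ℝ} (h0 : 0 ≤ p) (h1 : p ≤ 1) {f : Finset G → ℝ} (h : ∀ A, 0 ≤ f A) :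
    0 ≤ Ex p f := by
  have := Ex_mono h0 h1 h
  rwa [Ex_const] at this

lemma Ex_le_const {p : ℝ} (h0 : 0 ≤ p) (h1 : p ≤ 1) {f : Finset G → ℝ} {c : ℝ}
    (h : ∀ A, f A ≤ c) : Ex p f ≤ c := by
  have := Ex_mono h0 h1 h
  rwa [Ex_const] at this

lemma Ex_prod (p : ℝ) (t : G → ℝ) :
    Ex p (fun A => ∏ x ∈ A, t x) = ∏ x, (1 + p * (t x - 1)) := by
  unfold Ex
  have : ∀ A : Finset G, bernWeight p A * ∏ x ∈ A, t x
      = ∏ x, (if x ∈ A then p * t x else 1 - p) := by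
    intro A
    rw [bernWeight_eq]
    have : ∏ x ∈ A, t x = ∏ x, (if x ∈ A then t x else 1) := by
      rw [Finset.prod_ite]; simp
    rw [this, ← Finset.prod_mul_distrib]
    refine Finset.prod_congr rfl fun x _ => ?_
    split_ifs <;> simp
  simp_rw [this]
  rw [sum_prod_ite]
  exact Finset.prod_congr rfl fun x _ => by ring

lemma Ex_subset (p : ℝ) (S : Finset G) : Ex p (fun A => ind (S ⊆ A)) = p ^ S.card := by
  unfold Ex
  have : ∀ A : Finset G, bernWeight p A * ind (S ⊆ A)
      = ∏ x, (if x ∈ A then p else (if x ∈ S then 0 else 1 - p)) := by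
    intro A
    rw [bernWeight_eq]
    by_cases h : S ⊆ A
    · rw [ind_true h, mul_one]
      refine Finset.prod_congr rfl fun x _ => ?_
      by_cases hx : x ∈ A
      · simp [hx]
      · have hs : x ∉ S := fun h' => hx (h h')
        simp [hx, hs]
    · rw [ind_false h, mul_zero]
      rw [Finset.not_subset] at h
      obtain ⟨x, hx, hx'⟩ := h
      exact (Finset.prod_eq_zero (Finset.mem_univ x) (by simp [hx, hx'])).symm
  simp_rw [this]
  rw [sum_prod_ite]
  have : ∀ x, (p + (if x ∈ S then 0 else 1 - p)) = if x ∈ S then p else 1 := by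
    intro x; split_ifs <;> ring
  simp_rw [this]
  rw [Finset.prod_ite]; simp

lemma Ex_mem (p : ℝ) (x : G) : Ex p (fun A => ind (x ∈ A)) = p := by
  have := Ex_subset p ({x} : Finset G)
  simpa using this

lemma Ex_mem2 (p : ℝ) {x y : G} (h : x ≠ y) : Ex p (fun A => ind (x ∈ A) * ind (y ∈ A)) = p ^ 2 := by
  have := Ex_subset p ({x, y} : Finset G)
  rw [Finset.card_pair h] at this
  rw [← this]
  congr 1; ext A
  by_cases hx : x ∈ A <;> by_cases hy : y ∈ A <;> simp [ind, hx, hy, Finset.insert_subset_iff]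

lemma sum_mem_ind (A : Finset G) (h : G → ℝ) : ∑ x ∈ A, h x = ∑ x, ind (x ∈ A) * h x := by
  simp [ind]

lemma Ex_lin (p : ℝ) (h : G → ℝ) : Ex p (fun A => ∑ x ∈ A, h x) = p * ∑ x, h x := by
  rw [show (fun A : Finset G => ∑ x ∈ A, h x) = fun A => ∑ x, ind (x ∈ A) * h x from
    funext fun A => sum_mem_ind A h]
  rw [Ex_sum, Finset.mul_sum]
  refine Finset.sum_congr rfl fun x _ => ?_
  have : (fun A : Finset G => ind (x ∈ A) * h x) = fun A => h x * ind (x ∈ A) := by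
    ext; ring
  rw [this, Ex_mul, Ex_mem]; ring

lemma Ex_card (p : ℝ) : Ex p (fun A : Finset G => (A.card : ℝ)) = p * Fintype.card G := by
  have := Ex_lin (G := G) p (fun _ => 1)
  simpa using this

lemma Ex_quad {p : ℝ} (k : G → G → ℝ) (hk : ∀ x y, 0 ≤ k x y) :
    Ex p (fun A => ∑ x ∈ A, ∑ y ∈ A, k x y) ≤ p * ∑ x, k x x + p ^ 2 * ∑ x, ∑ y, k x y := by
  have e : (fun A : Finset G => ∑ x ∈ A, ∑ y ∈ A, k x y)
      = fun A => ∑ x, ∑ y, k x y * (ind (x ∈ A) * ind (y ∈ A)) := by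
    ext A
    rw [sum_mem_ind]
    refine Finset.sum_congr rfl fun x _ => ?_
    rw [sum_mem_ind, Finset.mul_sum]
    exact Finset.sum_congr rfl fun y _ => by ring
  rw [e, Ex_sum]
  simp_rw [Ex_sum, Ex_mul]
  rw [Finset.mul_sum, Finset.mul_sum, ← Finset.sum_add_distrib]
  refine Finset.sum_le_sum fun x _ => ?_
  have h1 : ∀ y, Ex p (fun A => ind (x ∈ A) * ind (y ∈ A)) ≤ (if y = x then p else 0) + p ^ 2 := by
    intro y
    by_cases h : x = y
    · subst h
      have : (fun A : Finset G => ind (x ∈ A) * ind (x ∈ A)) = fun A => ind (x ∈ A) := by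
        ext A; by_cases hx : x ∈ A <;> simp [ind, hx]
      rw [this, Ex_mem]; simp; positivity
    · rw [Ex_mem2 p h, if_neg (Ne.symm h)]; simp
  calc ∑ y, k x y * Ex p (fun A => ind (x ∈ A) * ind (y ∈ A))
      ≤ ∑ y, k x y * ((if y = x then p else 0) + p ^ 2) :=
        Finset.sum_le_sum fun y _ => mul_le_mul_of_nonneg_left (h1 y) (hk x y)
    _ = p * k x x + p ^ 2 * ∑ y, k x y := by
        simp_rw [mul_add]
        rw [Finset.sum_add_distrib]
        simp [← Finset.sum_mul]; ring

lemma markov {p : ℝ} (h0 : 0 ≤ p) (h1 : p ≤ 1) {f : Finset G → ℝ} (hf : ∀ A, 0 ≤ f A)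
    {m l : ℝ} (hl : 0 < l) (hm : Ex p f ≤ m) : Ex p (fun A => ind (l < f A)) ≤ m / l := by
  have : Ex p (fun A => l * ind (l < f A)) ≤ Ex p f := by
    refine Ex_mono h0 h1 fun A => ?_
    by_cases h : l < f A
    · rw [ind_true h]; linarith
    · rw [ind_false h]; simpa using hf A
  rw [Ex_mul] at this
  rw [le_div_iff₀ hl]; linarith

/-- Sequential bound. -/
lemma Ex_seq {p : ℝ} (h0 : 0 ≤ p) (h1 : p ≤ 1) {f : Finset G → ℝ} (bad : Finset G → Prop)
    {c e : ℝ} (hc : 0 ≤ c) (hf : ∀ A, f A ≤ 1) (hg : ∀ A, ¬ bad A → f A ≤ c)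
    (hb : Ex p (fun A => ind (bad A)) ≤ e) : Ex p f ≤ e + c := by
  have : Ex p f ≤ Ex p (fun A => ind (bad A) + c) := by
    refine Ex_mono h0 h1 fun A => ?_
    by_cases h : bad A
    · rw [ind_true h]; linarith [hf A]
    · rw [ind_false h]; linarith [hg A h]
  rw [Ex_add, Ex_const] at this
  linarith

lemma chernoff_upper {p : ℝ} (h0 : 0 ≤ p) (h1 : p ≤ 1) {d : G → ℝ} (hd : ∀ x, 0 ≤ d x)
    (hd1 : ∀ x, d x ≤ 1) (s : ℝ) :
    Ex p (fun A => ind (2 * (p * ∑ x, d x) + s < ∑ x ∈ A, d x)) ≤ Real.exp (-s) := by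
  have key : Ex p (fun A => ∏ x ∈ A, Real.exp (d x)) ≤ Real.exp (2 * (p * ∑ x, d x)) := by
    rw [Ex_prod, Finset.mul_sum, Finset.mul_sum, Real.exp_sum]
    refine Finset.prod_le_prod (fun x _ => ?_) (fun x _ => ?_)
    · have := Real.one_le_exp (hd x)
      nlinarith
    · have h2 : Real.exp (d x) ≤ 1 + 2 * d x := by
        have := Real.abs_exp_sub_one_sub_id_le (x := d x) (by rw [abs_of_nonneg (hd x)]; exact hd1 x)
        have h3 := abs_le.1 this
        nlinarith [hd x, hd1 x, h3.2]
      have h4 := Real.add_one_le_exp (2 * (p * d x))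
      nlinarith [hd x]
  have h3 : Ex p (fun A => Real.exp (2 * (p * ∑ x, d x) + s) * ind (2 * (p * ∑ x, d x) + s < ∑ x ∈ A, d x))
      ≤ Ex p (fun A => ∏ x ∈ A, Real.exp (d x)) := by
    refine Ex_mono h0 h1 fun A => ?_
    rw [← Real.exp_sum]
    by_cases h : 2 * (p * ∑ x, d x) + s < ∑ x ∈ A, d x
    · rw [ind_true h, mul_one]; exact Real.exp_le_exp.2 h.le
    · rw [ind_false h, mul_zero]; positivity
  rw [Ex_mul] at h3
  rw [Real.exp_add] at h3
  have h5 := h3.trans key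
  have h6 : Real.exp s * Ex p (fun A => ind (2 * (p * ∑ x, d x) + s < ∑ x ∈ A, d x)) ≤ 1 := by
    have hpos := Real.exp_pos (2 * (p * ∑ x, d x))
    rw [mul_assoc] at h5
    exact le_of_mul_le_mul_left (by simpa using h5) hpos
  rw [Real.exp_neg, ← one_div, le_div_iff₀ (Real.exp_pos _)]
  linarith

lemma chernoff_lower {p : ℝ} (h0 : 0 ≤ p) (h1 : p ≤ 1) {d : G → ℝ} {D μ : ℝ} (hD : 0 < D)
    (hd : ∀ x, 0 ≤ d x) (hd1 : ∀ x, d x ≤ D) (hμ : μ ≤ p * ∑ x, d x) :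
    Ex p (fun A => ind (∑ x ∈ A, d x < μ / 4)) ≤ Real.exp (- (μ / (4 * D))) := by
  have key : Ex p (fun A => ∏ x ∈ A, Real.exp (- (d x / D))) ≤ Real.exp (- (μ / (2 * D))) := by
    have : Real.exp (- (p * ∑ x, d x) / (2 * D)) ≤ Real.exp (- (μ / (2 * D))) := by
      apply Real.exp_le_exp.2
      rw [neg_div]
      apply neg_le_neg
      gcongr
    refine le_trans ?_ this
    rw [Ex_prod, Finset.mul_sum, ← Finset.sum_neg_distrib, Finset.sum_div, Real.exp_sum]
    refine Finset.prod_le_prod (fun x _ => ?_) (fun x _ => ?_)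
    · have := Real.exp_pos (-(d x / D))
      nlinarith
    · have hx0 : 0 ≤ d x / D := div_nonneg (hd x) hD.le
      have hx1 : d x / D ≤ 1 := (div_le_one hD).2 (hd1 x)
      set u := d x / D with hu
      have h2 : Real.exp (-u) ≤ 1 - u / 2 := by
        have h := Real.add_one_le_exp u
        rw [Real.exp_neg, inv_le_comm₀ (Real.exp_pos _) (by linarith)]
        refine le_trans ?_ h
        rw [inv_le_iff_one_le_mul₀ (by linarith)]
        nlinarith
      have h4 := Real.add_one_le_exp (-(p * d x) / (2 * D))
      have h5 : -(p * d x) / (2 * D) = - (p * u / 2) := by rw [hu]; field_simp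
      rw [h5] at h4 ⊢
      nlinarith
  have h3 : Ex p (fun A => Real.exp (-(μ / (4 * D))) * ind (∑ x ∈ A, d x < μ / 4))
      ≤ Ex p (fun A => ∏ x ∈ A, Real.exp (- (d x / D))) := by
    refine Ex_mono h0 h1 fun A => ?_
    rw [← Real.exp_sum]
    by_cases h : ∑ x ∈ A, d x < μ / 4
    · rw [ind_true h, mul_one]; apply Real.exp_le_exp.2
      rw [Finset.sum_neg_distrib, ← Finset.sum_div]
      apply neg_le_neg
      rw [← div_div]
      gcongr
    · rw [ind_false h, mul_zero]; positivity
  rw [Ex_mul] at h3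
  have h5 := h3.trans key
  have e : Real.exp (- (μ / (2 * D))) = Real.exp (-(μ / (4 * D))) * Real.exp (-(μ / (4 * D))) := by
    rw [← Real.exp_add]; congr 1; field_simp; ring
  rw [e] at h5
  exact le_of_mul_le_mul_left h5 (Real.exp_pos _)

lemma miss {p : ℝ} (_h0 : 0 ≤ p) (h1 : p ≤ 1) (W : Finset G) :
    Ex p (fun A => ind (∀ x ∈ A, x ∉ W)) ≤ Real.exp (- (p * W.card)) := by
  have e : (fun A : Finset G => ind (∀ x ∈ A, x ∉ W)) = fun A => ∏ x ∈ A, (if x ∈ W then (0:ℝ) else 1) := by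
    ext A
    by_cases h : ∀ x ∈ A, x ∉ W
    · rw [ind_true h]; symm; exact Finset.prod_eq_one fun x hx => by simp [h x hx]
    · rw [ind_false h]; push Not at h
      obtain ⟨x, hx, hx'⟩ := h
      exact (Finset.prod_eq_zero hx (by simp [hx'])).symm
  rw [e, Ex_prod]
  have : Real.exp (- (p * W.card)) = ∏ x : G, (if x ∈ W then Real.exp (-p) else 1) := by
    rw [Finset.prod_ite]; simp [← Real.exp_nat_mul]; ring
  rw [this]
  refine Finset.prod_le_prod (fun x _ => ?_) (fun x _ => ?_)
  · split_ifs
    · simp; linarith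
    · simp
  · split_ifs
    · linarith [Real.add_one_le_exp (-p)]
    · simp

lemma Ex_union {p p1 p2 : ℝ} (hp : 1 - p = (1 - p1) * (1 - p2)) (f : Finset G → ℝ) :
    Ex p f = Ex p1 (fun V => Ex p2 (fun A => f (V ∪ A))) := by
  have e : ∀ V A : Finset G, f (V ∪ A) = ∑ U, ind (V ∪ A = U) * f U := by
    intro V A; simp [ind]
  simp_rw [e]
  simp_rw [Ex_sum]
  rw [Ex]
  refine Finset.sum_congr rfl fun U _ => ?_
  have e2 : ∀ V, Ex p2 (fun A => ind (V ∪ A = U) * f U) = f U * Ex p2 (fun A => ind (V ∪ A = U)) := by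
    intro V; rw [← Ex_mul]; congr 1; ext; ring
  simp_rw [e2]
  rw [Ex_mul, mul_comm]
  congr 1
  have e3 : ∀ V A : Finset G, ind (V ∪ A = U) = ∏ x, ind ((x ∈ V ∨ x ∈ A) ↔ x ∈ U) := by
    intro V A
    by_cases h : V ∪ A = U
    · rw [ind_true h]; symm; refine Finset.prod_eq_one fun x _ => ind_true ?_
      rw [← h, Finset.mem_union]
    · rw [ind_false h]
      rw [Finset.ext_iff] at h; push Not at h
      obtain ⟨x, hx⟩ := h
      symm
      refine Finset.prod_eq_zero (Finset.mem_univ x) (ind_false ?_)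
      rw [Finset.mem_union] at hx
      tauto
  have e4 : ∀ V : Finset G, Ex p2 (fun A => ind (V ∪ A = U)) =
      ∏ x, (if x ∈ V then ind (x ∈ U) else (p2 * ind (x ∈ U) + (1 - p2) * ind (x ∉ U))) := by
    intro V
    unfold Ex
    simp_rw [e3, bernWeight_eq, ← Finset.prod_mul_distrib]
    have : ∀ A : Finset G, ∏ x, (if x ∈ A then p2 else 1 - p2) * ind ((x ∈ V ∨ x ∈ A) ↔ x ∈ U)
       = ∏ x, (if x ∈ A then p2 * ind (x ∈ U) else (1 - p2) * ind (x ∈ V ↔ x ∈ U)) := by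
      intro A
      refine Finset.prod_congr rfl fun x _ => ?_
      split_ifs with h <;> simp [h]
    simp_rw [this]
    rw [sum_prod_ite]
    refine Finset.prod_congr rfl fun x _ => ?_
    split_ifs with h
    · simp [h]; ring
    · simp [h]
  simp_rw [e4]
  unfold Ex
  simp_rw [bernWeight_eq, ← Finset.prod_mul_distrib]
  have : ∀ V : Finset G, ∏ x, (if x ∈ V then p1 else 1 - p1) *
      (if x ∈ V then ind (x ∈ U) else (p2 * ind (x ∈ U) + (1 - p2) * ind (x ∉ U)))
      = ∏ x, (if x ∈ V then p1 * ind (x ∈ U) else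
        (1 - p1) * (p2 * ind (x ∈ U) + (1 - p2) * ind (x ∉ U))) := by
    intro V
    refine Finset.prod_congr rfl fun x _ => ?_
    split_ifs with h <;> simp
  simp_rw [this]
  rw [sum_prod_ite]
  refine Finset.prod_congr rfl fun x _ => ?_
  by_cases h : x ∈ U
  · simp [h, ind]; linarith
  · simp [h, ind]; linarith

lemma prob_eq (p : ℝ) (E : Finset G → Prop) : randomSubsetProb G p E = 1 - Ex p (fun A => ind (¬ E A)) := by
  have h := Ex_add (G := G) p (fun A => ind (E A)) (fun A => ind (¬ E A))
  have h2 : (fun A => ind (E A) + ind (¬ E A)) = fun _ : Finset G => (1:ℝ) := by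
    ext A; by_cases hA : E A <;> simp [ind, hA]
  rw [h2, Ex_const] at h
  have h3 : randomSubsetProb G p E = Ex p (fun A => ind (E A)) := by
    unfold randomSubsetProb Ex ind
    refine Finset.sum_congr rfl fun A _ => ?_
    by_cases hA : E A <;> simp [hA]
  rw [h3]; linarith

end Prob

/-! ### Characters and stability -/

lemma char_avg {H : Type*} [AddCommGroup H] [AddGroup.FG H] {ι : Type*} (I : Finset ι) (h : ι → H)
    (T : ℝ) (hT : ∀ χ : AddChar H ℂ, (∀ a, ‖χ a‖ = 1) → ∑ i ∈ I, ‖χ (h i) - 1‖ ≤ T) :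
    ((I.filter (fun i => h i ≠ 0)).card : ℝ) ≤ T := by
  set J := I.filter (fun i => h i ≠ 0) with hJ
  have hc : ∀ i : ι, ∃ c : CharacterModule H, h i ≠ 0 → c (h i) ≠ 0 := by
    intro i
    by_cases hi : h i = 0
    · exact ⟨0, fun h' => absurd hi h'⟩
    · obtain ⟨c, hc⟩ := CharacterModule.exists_character_apply_ne_zero_of_ne_zero hi
      exact ⟨c, fun _ => hc⟩
  choose c hc using hc
  let q : H →+ (J → AddCircle (1 : ℚ)) := AddMonoidHom.pi (fun i : J => (c i : H →+ AddCircle (1:ℚ)))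
  let Q := q.range
  have hfg : AddGroup.FG Q := inferInstance
  have htor : ∀ x : Q, IsOfFinAddOrder x := by
    rintro ⟨x, hx⟩
    have h1 : ∀ i : J, IsOfFinAddOrder (x i) := by
      intro i
      obtain ⟨y, hy⟩ := QuotientAddGroup.mk_surjective (x i)
      rw [← hy]
      rw [isOfFinAddOrder_iff_nsmul_eq_zero]
      refine ⟨y.den, y.den_pos, ?_⟩
      rw [← QuotientAddGroup.mk_nsmul]
      rw [QuotientAddGroup.eq_zero_iff]
      refine ⟨y.num, ?_⟩
      simp [Rat.den_mul_eq_num]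
    have h2 : IsOfFinAddOrder x := by
      choose k hk using fun i => (isOfFinAddOrder_iff_nsmul_eq_zero).1 (h1 i)
      rw [isOfFinAddOrder_iff_nsmul_eq_zero]
      refine ⟨∏ i, k i, Finset.prod_pos fun i _ => (hk i).1, ?_⟩
      funext i
      obtain ⟨m, hm⟩ := Finset.dvd_prod_of_mem k (Finset.mem_univ i)
      rw [hm, Pi.smul_apply, mul_comm, mul_nsmul', (hk i).2]; simp
    rw [isOfFinAddOrder_iff_nsmul_eq_zero] at h2 ⊢
    obtain ⟨n, hn, hx'⟩ := h2
    exact ⟨n, hn, Subtype.ext hx'⟩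
  have hfin : Finite Q := AddCommGroup.finite_of_fg_isAddTorsion Q htor
  have : Fintype Q := Fintype.ofFinite Q
  have hsum : ∀ ψ : AddChar Q ℂ, ∑ i ∈ J, ‖ψ (q.rangeRestrict (h i)) - 1‖ ≤ T := by
    intro ψ
    have := hT (ψ.compAddMonoidHom q.rangeRestrict) (fun a => by
      simp)
    refine le_trans ?_ this
    exact Finset.sum_le_sum_of_subset_of_nonneg (Finset.filter_subset _ _)
      (fun _ _ _ => norm_nonneg _)
  have h1 : ∑ ψ : AddChar Q ℂ, ∑ i ∈ J, ‖ψ (q.rangeRestrict (h i)) - 1‖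
      ≤ Fintype.card (AddChar Q ℂ) * T := by
    refine (Finset.sum_le_card_nsmul _ _ T fun ψ _ => hsum ψ).trans ?_
    simp
  rw [Finset.sum_comm] at h1
  have h2 : ∀ i ∈ J, (Fintype.card (AddChar Q ℂ) : ℝ) ≤
      ∑ ψ : AddChar Q ℂ, ‖ψ (q.rangeRestrict (h i)) - 1‖ := by
    intro i hi
    have hne : q.rangeRestrict (h i) ≠ 0 := by
      intro h0
      have h0' : q (h i) = 0 := congrArg Subtype.val h0
      have := congrFun h0' ⟨i, hi⟩
      exact hc i (Finset.mem_filter.1 hi).2 this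
    have h3 : ∑ ψ : AddChar Q ℂ, ψ (q.rangeRestrict (h i)) = 0 :=
      AddChar.sum_apply_eq_zero_iff_ne_zero.2 hne
    calc (Fintype.card (AddChar Q ℂ) : ℝ)
        = ‖∑ ψ : AddChar Q ℂ, (ψ (q.rangeRestrict (h i)) - 1)‖ := by
          rw [Finset.sum_sub_distrib, h3]; simp
      _ ≤ _ := norm_sum_le _ _
  have h4 : (J.card : ℝ) * Fintype.card (AddChar Q ℂ) ≤ Fintype.card (AddChar Q ℂ) * T := by
    refine le_trans ?_ h1
    have := Finset.card_nsmul_le_sum J _ _ h2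
    simpa using this
  have hpos : (0:ℝ) < Fintype.card (AddChar Q ℂ) := by
    exact_mod_cast Fintype.card_pos
  nlinarith

lemma stability {G H : Type*} [AddCommGroup G] [Fintype G] [AddCommGroup H] (f : G → H)
    (κ η : ℝ) (hκ : κ < η / 2) (hη : η < 1 / 6) (hη0 : 0 < η)
    (hf : (((Finset.univ : Finset (G × G × G)).filter
      (fun t => f t.1 + f t.2.1 - f t.2.2 - f (t.1 + t.2.1 - t.2.2) ≠ 0)).card : ℝ)
        ≤ κ * (Fintype.card G : ℝ) ^ 3) :
    ∃ (ψ : G →+ H) (c : H),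
      (((Finset.univ : Finset G).filter (fun x => f x ≠ ψ x + c)).card : ℝ)
        ≤ 2 * η * Fintype.card G := by
  set n : ℝ := (Fintype.card G : ℝ) with hn
  have hn0 : 0 < n := by rw [hn]; exact_mod_cast Fintype.card_pos
  have hav : ∀ (k : G → ℝ) (m : ℝ), ∑ x, k x ≤ m * n → ∃ x, k x ≤ m := by
    intro k m h
    by_contra hcon
    push Not at hcon
    have := Finset.sum_lt_sum_of_nonempty (s := (Finset.univ : Finset G)) Finset.univ_nonempty
      (fun x _ => hcon x)
    simp only [Finset.sum_const, Finset.card_univ, nsmul_eq_mul] at this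
    rw [← hn] at this
    linarith
  let bad : G → ℝ := fun d => ∑ y, ∑ x, ind (f (x + d) - f x ≠ f (y + d) - f y)
  have hbad : ∑ d, bad d ≤ κ * n ^ 3 := by
    refine le_trans (le_of_eq ?_) hf
    rw [card_filter_ind]
    simp only [bad]
    rw [← Fintype.sum_prod_type', ← Fintype.sum_prod_type']
    refine Fintype.sum_equiv
      { toFun := fun t : (G × G) × G => (t.2 + t.1.1, t.1.2, t.1.2 + t.1.1)
        invFun := fun t : G × G × G => ((t.2.2 - t.2.1, t.2.1), t.1 + t.2.1 - t.2.2)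
        left_inv := by rintro ⟨⟨d, y⟩, x⟩; simp; abel
        right_inv := by rintro ⟨a, b, c⟩; simp } _ _ ?_
    rintro ⟨⟨d, y⟩, x⟩
    simp only [Equiv.coe_fn_mk]
    have e1 : x + d + y - (y + d) = x := by rw [add_assoc, add_comm d y, add_sub_cancel_right]
    refine ind_congr ?_
    rw [e1]
    refine not_congr ?_
    constructor
    · intro h
      have : f (x + d) - f x - (f (y + d) - f y) = 0 := by rw [h]; simp
      rw [← this]; abel
    · intro h
      rw [← sub_eq_zero, ← h]; abel
  let D : Finset G := Finset.univ.filter (fun d => bad d ≤ η * n * n)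
  have hD : ((Dᶜ).card : ℝ) < n / 2 := by
    have h1 : ((Dᶜ).card : ℝ) * (η * n * n) ≤ ∑ d, bad d := by
      calc ((Dᶜ).card : ℝ) * (η * n * n) = ∑ d ∈ Dᶜ, (η * n * n) := by simp
        _ ≤ ∑ d ∈ Dᶜ, bad d := Finset.sum_le_sum fun d hd => by
            simp only [D, Finset.mem_compl, Finset.mem_filter, Finset.mem_univ, true_and,
              not_le] at hd
            exact hd.le
        _ ≤ ∑ d, bad d := Finset.sum_le_sum_of_subset_of_nonneg (Finset.subset_univ _)
            (fun d _ _ => Finset.sum_nonneg fun _ _ => Finset.sum_nonneg fun _ _ => ind_nonneg _)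
    have h2 : ((Dᶜ).card : ℝ) * (η * n * n) < n / 2 * (η * n * n) := by
      have : κ * n ^ 3 < η / 2 * n ^ 3 := by gcongr
      calc _ ≤ κ * n ^ 3 := h1.trans hbad
        _ < η / 2 * n ^ 3 := this
        _ = _ := by ring
    exact lt_of_mul_lt_mul_right h2 (by positivity)
  have hval : ∀ d ∈ D, ∃ v : H, ∑ x, ind (f (x + d) - f x ≠ v) ≤ η * n := by
    intro d hd
    have hd' : bad d ≤ η * n * n := (Finset.mem_filter.1 hd).2
    obtain ⟨y, hy⟩ := hav _ _ hd'
    exact ⟨_, hy⟩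
  have hsplit : ∀ g : G, ∃ d ∈ D, g - d ∈ D := by
    intro g
    by_contra hcon
    push Not at hcon
    have h1 : D.card ≤ (Dᶜ).card := by
      refine Finset.card_le_card_of_injOn (fun d => g - d) (fun d hd => ?_) ?_
      · simpa using hcon d hd
      · intro a _ b _ hab; simpa using hab
    have h2 : (D.card : ℝ) + (Dᶜ).card = n := by
      rw [hn]; exact_mod_cast Finset.card_add_card_compl D
    have h3 : (D.card : ℝ) ≤ (Dᶜ).card := by exact_mod_cast h1
    linarith
  have hall : ∀ g : G, ∃ v : H, ∑ x, ind (f (x + g) - f x ≠ v) ≤ 2 * η * n := by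
    intro g
    obtain ⟨d, hd, hd'⟩ := hsplit g
    obtain ⟨v, hv⟩ := hval d hd
    obtain ⟨v', hv'⟩ := hval _ hd'
    refine ⟨v + v', ?_⟩
    have h1 : ∑ x, ind (f (x + d + (g - d)) - f (x + d) ≠ v') ≤ η * n := by
      refine le_trans (le_of_eq ?_) hv'
      exact Fintype.sum_equiv (Equiv.addRight d) _ _ (fun x => rfl)
    have h2 : ∑ x, ind (f (x + g) - f x ≠ v + v') ≤
        ∑ x, (ind (f (x + d) - f x ≠ v) + ind (f (x + d + (g - d)) - f (x + d) ≠ v')) := by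
      refine Finset.sum_le_sum fun x _ => ?_
      refine le_trans (ind_mono ?_) ind_or
      intro h
      by_contra hcon
      push Not at hcon
      apply h
      rw [← hcon.1, ← hcon.2]
      have : x + d + (g - d) = x + g := by abel
      rw [this]; abel
    rw [Finset.sum_add_distrib] at h2
    linarith
  choose v hv using hall
  have hadd : ∀ g g', v (g + g') = v g + v g' := by
    intro g g'
    have h1 := hv g
    have h2 : ∑ x, ind (f (x + g + g') - f (x + g) ≠ v g') ≤ 2 * η * n := by
      refine le_trans (le_of_eq ?_) (hv g')
      exact Fintype.sum_equiv (Equiv.addRight g) _ _ (fun x => rfl)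
    have h3 := hv (g + g')
    have : ∑ x, (ind (f (x + g) - f x ≠ v g) + ind (f (x + g + g') - f (x + g) ≠ v g')
        + ind (f (x + (g + g')) - f x ≠ v (g + g'))) ≤ 6 * η * n := by
      rw [Finset.sum_add_distrib, Finset.sum_add_distrib]; linarith
    obtain ⟨x, hx⟩ := hav _ _ this
    have hlt : 6 * η < 1 := by linarith
    have hz : ∀ P : Prop, ind P < 1 → ¬ P := by
      intro P hP h; rw [ind_true h] at hP; exact lt_irrefl _ hP
    have p1 := ind_nonneg (f (x + g) - f x ≠ v g)
    have p2 := ind_nonneg (f (x + g + g') - f (x + g) ≠ v g')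
    have p3 := ind_nonneg (f (x + (g + g')) - f x ≠ v (g + g'))
    have q1 := hz (f (x + g) - f x ≠ v g) (by linarith)
    have q2 := hz (f (x + g + g') - f (x + g) ≠ v g') (by linarith)
    have q3 := hz (f (x + (g + g')) - f x ≠ v (g + g')) (by linarith)
    push Not at q1 q2 q3
    rw [← q1, ← q2, ← q3, add_assoc]; abel
  have hsum : ∑ x, ∑ g, ind (f (x + g) - f x ≠ v g) ≤ 2 * η * n * n := by
    rw [Finset.sum_comm]
    refine (Finset.sum_le_card_nsmul _ _ _ fun g _ => hv g).trans (le_of_eq ?_)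
    simp only [Finset.card_univ, nsmul_eq_mul, ← hn]; ring
  obtain ⟨x, hx⟩ := hav _ _ hsum
  let ψ : G →+ H := AddMonoidHom.mk' v hadd
  refine ⟨ψ, f x - v x, ?_⟩
  refine le_trans (le_of_eq ?_) hx
  rw [card_filter_ind]
  refine Fintype.sum_equiv (Equiv.subRight x) _ _ ?_
  intro y
  simp only [Equiv.subRight_apply, add_sub_cancel]
  refine ind_congr (not_congr ?_)
  have e : v y = v (y - x) + v x := by rw [← hadd, sub_add_cancel]
  change f y = v y + (f x - v x) ↔ _
  rw [e, sub_eq_iff_eq_add]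
  have : v (y - x) + v x + (f x - v x) = v (y - x) + f x := by abel
  rw [this]

/-! ### The deterministic deduction -/

open scoped ComplexConjugate in
/-- The unimodular function induced by `θ` through the representations `ra + rb - rc`. -/
def gfun {G : Type*} (ra rb rc : G → G) (θ : G → ℂ) (x : G) : ℂ :=
  θ (ra x) * θ (rb x) * conj (θ (rc x))

open scoped ComplexConjugate in
/-- The multiplicative derivative along an additive quadruple. -/
def quadv {G : Type*} [AddCommGroup G] (g : G → ℂ) (x y z : G) : ℂ :=
  g x * g y * conj (g z) * conj (g (x + y - z))

/-- `θ` takes values in the net on `V` and is `1` elsewhere. -/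
def netfun {G : Type*} (V : Finset G) (N : Finset ℂ) (θ : G → ℂ) : Prop :=
  ∀ x, (x ∈ V → θ x ∈ N) ∧ (x ∉ V → θ x = 1)

lemma norm_mul_sub {a b c d : ℂ} (hb : ‖b‖ ≤ 1) (hc : ‖c‖ ≤ 1) :
    ‖a * b - c * d‖ ≤ ‖a - c‖ + ‖b - d‖ := by
  have : a * b - c * d = (a - c) * b + c * (b - d) := by ring
  rw [this]
  refine (norm_add_le _ _).trans ?_
  rw [norm_mul, norm_mul]
  have h1 := mul_le_mul_of_nonneg_left hb (norm_nonneg (a - c))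
  have h2 := mul_le_mul_of_nonneg_right hc (norm_nonneg (b - d))
  linarith

lemma norm_conj_sub (a b : ℂ) : ‖(starRingEnd ℂ) a - (starRingEnd ℂ) b‖ = ‖a - b‖ := by
  rw [← map_sub, RCLike.norm_conj]

lemma char_sub {H : Type*} [AddCommGroup H] (χ : AddChar H ℂ) (h1 : ∀ a, ‖χ a‖ = 1) (a b : H) :
    χ (a - b) = χ a * (starRingEnd ℂ) (χ b) := by
  have h2 : χ (a - b) * χ b = χ a := by rw [← AddChar.map_add_eq_mul, sub_add_cancel]
  have h3 : χ b * (starRingEnd ℂ) (χ b) = 1 := by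
    rw [Complex.mul_conj, Complex.normSq_eq_norm_sq, h1]; simp
  rw [← h2, mul_assoc, h3, mul_one]

lemma norm_gfun {G : Type*} {ra rb rc : G → G} {θ : G → ℂ} (h : ∀ x, ‖θ x‖ = 1) (x : G) :
    ‖gfun ra rb rc θ x‖ = 1 := by
  simp [gfun, h]

lemma quadv_sub {G : Type*} [AddCommGroup G] {g g' : G → ℂ} (hg : ∀ x, ‖g x‖ = 1)
    (hg' : ∀ x, ‖g' x‖ = 1) {x y z : G} {e : ℝ} (hx : ‖g x - g' x‖ ≤ e) (hy : ‖g y - g' y‖ ≤ e)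
    (hz : ‖g z - g' z‖ ≤ e) (hw : ‖g (x + y - z) - g' (x + y - z)‖ ≤ e) :
    ‖quadv g x y z - quadv g' x y z‖ ≤ 4 * e := by
  unfold quadv
  have h1 := norm_mul_sub (a := g x * g y * (starRingEnd ℂ) (g z)) (c := g' x * g' y * (starRingEnd ℂ) (g' z))
    (b := (starRingEnd ℂ) (g (x + y - z))) (d := (starRingEnd ℂ) (g' (x + y - z)))
    (by simp [hg]) (by simp [hg'])
  have h2 := norm_mul_sub (a := g x * g y) (c := g' x * g' y)
    (b := (starRingEnd ℂ) (g z)) (d := (starRingEnd ℂ) (g' z))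
    (by simp [hg]) (by simp [hg'])
  have h3 := norm_mul_sub (a := g x) (c := g' x) (b := g y) (d := g' y)
    (by simp [hg]) (by simp [hg'])
  rw [norm_conj_sub] at h1 h2
  linarith

lemma det {G : Type*} [AddCommGroup G] [Fintype G] {U V A1 A2 A3 B S : Finset G}
    (hV : V ⊆ U) (hA1 : A1 ⊆ U) (hA2 : A2 ⊆ U) (hA3 : A3 ⊆ U) (hB : B ⊆ U)
    {ra rb rc : G → G}
    (hr : ∀ x ∈ S, ra x ∈ V ∧ rb x ∈ V ∧ rc x ∈ V ∧ ra x + rb x - rc x = x)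
    {N : Finset ℂ} {e : ℝ} (hN1 : ∀ u ∈ N, ‖u‖ = 1) (hN : ∀ u : ℂ, ‖u‖ = 1 → ∃ w ∈ N, ‖u - w‖ ≤ e)
    {s s2 η1 η p : ℝ} (he : 0 ≤ e) (hp : 0 ≤ p)
    (hS : ((Sᶜ).card : ℝ) ≤ s * Fintype.card G)
    (hP1 : ∀ θ, netfun V N θ →
      (∀ x ∈ A1, ∀ y ∈ A2, ∀ z ∈ A3, x + y - z ∈ B → x ∈ S → y ∈ S → z ∈ S → x + y - z ∈ S →
        ‖quadv (gfun ra rb rc θ) x y z - 1‖ ≤ 12 * e) →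
      ∑ x, ∑ y, ∑ z, ind (x ∈ S ∧ y ∈ S ∧ z ∈ S ∧ x + y - z ∈ S ∧
        12 * e < ‖quadv (gfun ra rb rc θ) x y z - 1‖) ≤ η1 * (Fintype.card G : ℝ) ^ 3)
    (hP2 : ∀ θ, netfun V N θ → ∀ c ∈ N, ∀ γ : AddChar G ℂ,
      ∑ x ∈ B, ‖gfun ra rb rc θ x - c * γ x‖ ≤
        2 * (p * ∑ x, ‖gfun ra rb rc θ x - c * γ x‖) + s2)
    (hη : 2 * η1 + 8 * s + 24 * e < η / 2) (hη6 : η < 1 / 6) (hη0 : 0 < η)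
    {H : Type*} [AddCommGroup H] [AddGroup.FG H] (φ : G → H) (hφ : FreimanHomOn U φ) :
    ∃ (ψ : G →+ H) (c : H), (((B ∩ S).filter (fun x => φ x ≠ ψ x + c)).card : ℝ) ≤
      2 * p * ((4 * η + 4 * e + 2 * s) * Fintype.card G) + s2 + 4 * e * B.card := by
  set n : ℝ := (Fintype.card G : ℝ) with hn
  have hn0 : 0 < n := by rw [hn]; exact_mod_cast Fintype.card_pos
  let f : G → H := fun x => φ (ra x) + φ (rb x) - φ (rc x)
  have hfφ : ∀ x ∈ S, x ∈ U → f x = φ x := by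
    intro x hx hxU
    obtain ⟨h1, h2, h3, h4⟩ := hr x hx
    have := hφ _ (hV h1) _ (hV h2) _ hxU _ (hV h3) (sub_eq_iff_eq_add.1 h4)
    simp only [f]
    rw [this, add_sub_cancel_right]
  -- the net approximation of a character
  have happ : ∀ χ : AddChar H ℂ, (∀ a, ‖χ a‖ = 1) → ∃ θ, netfun V N θ ∧ (∀ x, ‖θ x‖ = 1) ∧
      ∀ x ∈ S, ‖χ (f x) - gfun ra rb rc θ x‖ ≤ 3 * e := by
    intro χ hχ
    choose w hw hw' using fun x => hN (χ (φ x)) (hχ _)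
    let θ : G → ℂ := fun x => if x ∈ V then w x else 1
    have h1 : ∀ x, ‖θ x‖ = 1 := by
      intro x; simp only [θ]; split_ifs
      · exact hN1 _ (hw x)
      · simp
    refine ⟨θ, fun x => ⟨fun hx => by simp [θ, hx, hw], fun hx => by simp [θ, hx]⟩, h1, ?_⟩
    intro x hx
    obtain ⟨ha, hb, hc, -⟩ := hr x hx
    have hθ : ∀ y ∈ V, ‖χ (φ y) - θ y‖ ≤ e := by
      intro y hy; simp only [θ, hy, if_true]; exact hw' y
    have e1 : χ (f x) = χ (φ (ra x)) * χ (φ (rb x)) * (starRingEnd ℂ) (χ (φ (rc x))) := by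
      simp only [f]; rw [char_sub χ hχ, AddChar.map_add_eq_mul]
    rw [e1]
    unfold gfun
    have q1 := norm_mul_sub (a := χ (φ (ra x)) * χ (φ (rb x))) (c := θ (ra x) * θ (rb x))
      (b := (starRingEnd ℂ) (χ (φ (rc x)))) (d := (starRingEnd ℂ) (θ (rc x)))
      (by simp [hχ]) (by simp [h1])
    have q2 := norm_mul_sub (a := χ (φ (ra x))) (c := θ (ra x)) (b := χ (φ (rb x))) (d := θ (rb x))
      (by simp [hχ]) (by simp [h1])
    rw [norm_conj_sub] at q1
    linarith [hθ _ ha, hθ _ hb, hθ _ hc]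
  have htwo : ∀ a b : ℂ, ‖a‖ = 1 → ‖b‖ = 1 → ‖a - b‖ ≤ 2 := by
    intro a b ha hb
    refine (norm_sub_le _ _).trans ?_
    rw [ha, hb]; norm_num
  have hquad : ∀ χ : AddChar H ℂ, (∀ a, ‖χ a‖ = 1) → ∀ x y z,
      χ (f x + f y - f z - f (x + y - z)) = quadv (fun x => χ (f x)) x y z := by
    intro χ hχ x y z
    rw [char_sub χ hχ, char_sub χ hχ, AddChar.map_add_eq_mul]; rfl
  have hSind : ∑ x, ind (x ∉ S) ≤ s * n := by
    refine le_trans (le_of_eq ?_) hS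
    rw [← @card_filter_ind G Finset.univ (fun x => x ∉ S) (Classical.decPred _)]
    congr 2; ext; simp
  -- Step 1 : most quadruples are respected
  have step1 : (((Finset.univ : Finset (G × G × G)).filter
      (fun t => f t.1 + f t.2.1 - f t.2.2 - f (t.1 + t.2.1 - t.2.2) ≠ 0)).card : ℝ)
        ≤ (2 * η1 + 8 * s + 24 * e) * n ^ 3 := by
    refine char_avg Finset.univ (fun t : G × G × G => f t.1 + f t.2.1 - f t.2.2 - f (t.1 + t.2.1 - t.2.2)) _ ?_
    intro χ hχ
    obtain ⟨θ, hθ, hθ1, hθf⟩ := happ χ hχ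
    set g := gfun ra rb rc θ with hg
    have hg1 : ∀ x, ‖g x‖ = 1 := norm_gfun hθ1
    have hclose : ∀ x y z, x ∈ S → y ∈ S → z ∈ S → x + y - z ∈ S →
        ‖quadv (fun x => χ (f x)) x y z - quadv g x y z‖ ≤ 12 * e := by
      intro x y z hx hy hz hw
      have := quadv_sub (g := fun x => χ (f x)) (g' := g) (fun x => hχ _) hg1
        (hθf x hx) (hθf y hy) (hθf z hz) (hθf _ hw)
      linarith
    have hbad := hP1 θ hθ (by
      intro x hx y hy z hz hw hxS hyS hzS hwS
      have h1 := hclose x y z hxS hyS hzS hwS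
      have h2 : f x + f y - f z - f (x + y - z) = 0 := by
        rw [hfφ x hxS (hA1 hx), hfφ y hyS (hA2 hy), hfφ z hzS (hA3 hz), hfφ _ hwS (hB hw)]
        have := hφ _ (hA1 hx) _ (hA2 hy) _ (hA3 hz) _ (hB hw) (by abel)
        rw [this]; abel
      rw [← hquad χ hχ, h2, AddChar.map_zero_eq_one] at h1
      rwa [norm_sub_rev])
    rw [Fintype.sum_prod_type]
    simp_rw [Fintype.sum_prod_type]
    have hpt : ∀ x y z, ‖χ (f x + f y - f z - f (x + y - z)) - 1‖ ≤
        2 * ind (x ∈ S ∧ y ∈ S ∧ z ∈ S ∧ x + y - z ∈ S ∧ 12 * e < ‖quadv g x y z - 1‖)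
        + 2 * (ind (x ∉ S) + ind (y ∉ S) + ind (z ∉ S) + ind (x + y - z ∉ S)) + 24 * e := by
      intro x y z
      have b2 : ‖χ (f x + f y - f z - f (x + y - z)) - 1‖ ≤ 2 := htwo _ _ (hχ _) (by simp)
      have i1 := ind_nonneg (x ∉ S)
      have i2 := ind_nonneg (y ∉ S)
      have i3 := ind_nonneg (z ∉ S)
      have i4 := ind_nonneg (x + y - z ∉ S)
      have i5 := ind_nonneg (x ∈ S ∧ y ∈ S ∧ z ∈ S ∧ x + y - z ∈ S ∧ 12 * e < ‖quadv g x y z - 1‖)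
      by_cases hx : x ∈ S
      swap
      · rw [ind_true hx]; linarith
      by_cases hy : y ∈ S
      swap
      · rw [ind_true hy]; linarith
      by_cases hz : z ∈ S
      swap
      · rw [ind_true hz]; linarith
      by_cases hw : x + y - z ∈ S
      swap
      · rw [ind_true hw]; linarith
      by_cases hq : 12 * e < ‖quadv g x y z - 1‖
      · rw [ind_true (⟨hx, hy, hz, hw, hq⟩ : _ ∧ _ ∧ _ ∧ _ ∧ _)]; linarith
      · have h1 := hclose x y z hx hy hz hw
        rw [hquad χ hχ]
        have h2 : ‖quadv (fun x => χ (f x)) x y z - 1‖ ≤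
          ‖quadv (fun x => χ (f x)) x y z - quadv g x y z‖ + ‖quadv g x y z - 1‖ :=
          norm_sub_le_norm_sub_add_norm_sub _ _ _
        linarith
    refine (Finset.sum_le_sum fun x _ => Finset.sum_le_sum fun y _ => Finset.sum_le_sum
      fun z _ => hpt x y z).trans ?_
    have hw : ∀ x y, ∑ z, ind (x + y - z ∉ S) = ∑ x, ind (x ∉ S) := by
      intro x y
      exact Fintype.sum_equiv (Equiv.subLeft (x + y)) _ _ (fun z => rfl)
    simp only [Finset.sum_add_distrib, ← Finset.mul_sum, hw]
    simp only [Finset.sum_const, Finset.card_univ, nsmul_eq_mul, ← hn, ← Finset.mul_sum]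
    have := mul_le_mul_of_nonneg_left hSind (by positivity : 0 ≤ n * n)
    nlinarith [hbad]
  -- Step 2 : stability
  obtain ⟨ψ, c, hψ⟩ := stability f _ η hη hη6 hη0 step1
  refine ⟨ψ, c, ?_⟩
  have hfin : (((B ∩ S).filter (fun x => f x - (ψ x + c) ≠ 0)).card : ℝ) ≤
      2 * p * ((4 * η + 4 * e + 2 * s) * n) + s2 + 4 * e * B.card := by
    refine char_avg (B ∩ S) (fun x => f x - (ψ x + c)) _ ?_
    intro χ hχ
    obtain ⟨θ, hθ, hθ1, hθf⟩ := happ χ hχ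
    obtain ⟨u, hu, huc⟩ := hN (χ c) (hχ _)
    let γ : AddChar G ℂ := χ.compAddMonoidHom ψ
    have hγ : ∀ x, γ x = χ (ψ x) := fun x => rfl
    have hp2 := hP2 θ hθ u hu γ
    set g := gfun ra rb rc θ with hg
    have hg1 : ∀ x, ‖g x‖ = 1 := norm_gfun hθ1
    have e1 : ∀ x, ‖χ (f x - (ψ x + c)) - 1‖ = ‖χ (f x) - χ (ψ x + c)‖ := by
      intro x
      have : χ (f x) = χ (f x - (ψ x + c)) * χ (ψ x + c) := by
        rw [← AddChar.map_add_eq_mul, sub_add_cancel]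
      have h2 : χ (f x) - χ (ψ x + c) = (χ (f x - (ψ x + c)) - 1) * χ (ψ x + c) := by
        rw [sub_mul, ← this, one_mul]
      rw [h2, norm_mul, hχ, mul_one]
    have e2 : ∀ x, ‖χ (ψ x + c) - u * γ x‖ ≤ e := by
      intro x
      have : χ (ψ x + c) - u * γ x = (χ c - u) * γ x := by
        rw [AddChar.map_add_eq_mul, hγ]; ring
      rw [this, norm_mul, hγ, hχ, mul_one]; exact huc
    have huγ : ∀ x, ‖u * γ x‖ = 1 := by
      intro x; rw [norm_mul, hγ, hχ, hN1 u hu, mul_one]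
    have hpt1 : ∀ x ∈ S, ‖χ (f x) - χ (ψ x + c)‖ ≤ ‖g x - u * γ x‖ + 4 * e := by
      intro x hx
      have h1 := norm_sub_le_norm_sub_add_norm_sub (χ (f x)) (g x) (χ (ψ x + c))
      have h2 := norm_sub_le_norm_sub_add_norm_sub (g x) (u * γ x) (χ (ψ x + c))
      have h3 := e2 x
      rw [norm_sub_rev] at h3
      linarith [hθf x hx]
    have hpt2 : ∀ x, ‖g x - u * γ x‖ ≤ 2 * ind (f x ≠ ψ x + c) + 2 * ind (x ∉ S) + 4 * e := by
      intro x
      have b2 := htwo _ _ (hg1 x) (huγ x)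
      have i1 := ind_nonneg (x ∉ S)
      have i2 := ind_nonneg (f x ≠ ψ x + c)
      by_cases hx : x ∈ S
      swap
      · rw [ind_true hx]; linarith
      by_cases hfx : f x = ψ x + c
      swap
      · rw [ind_true hfx]; linarith
      have h1 := norm_sub_le_norm_sub_add_norm_sub (g x) (χ (f x)) (u * γ x)
      have h3 := e2 x
      rw [← hfx] at h3
      have h4 := hθf x hx
      rw [norm_sub_rev] at h4
      linarith
    have hG : ∑ x, ‖g x - u * γ x‖ ≤ (4 * η + 4 * e + 2 * s) * n := by
      refine (Finset.sum_le_sum fun x _ => hpt2 x).trans ?_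
      rw [Finset.sum_add_distrib, Finset.sum_add_distrib, ← Finset.mul_sum, ← Finset.mul_sum]
      rw [card_filter_ind] at hψ
      simp only [Finset.sum_const, Finset.card_univ, nsmul_eq_mul, ← hn]
      linarith
    calc ∑ x ∈ B ∩ S, ‖χ (f x - (ψ x + c)) - 1‖
        ≤ ∑ x ∈ B ∩ S, (‖g x - u * γ x‖ + 4 * e) := by
          refine Finset.sum_le_sum fun x hx => ?_
          rw [e1]; exact hpt1 x (Finset.mem_inter.1 hx).2
      _ ≤ ∑ x ∈ B, (‖g x - u * γ x‖ + 4 * e) :=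
          Finset.sum_le_sum_of_subset_of_nonneg Finset.inter_subset_left
            (fun x _ _ => by positivity)
      _ = ∑ x ∈ B, ‖g x - u * γ x‖ + 4 * e * B.card := by
          rw [Finset.sum_add_distrib]; simp; ring
      _ ≤ _ := by
          have := mul_le_mul_of_nonneg_left hG hp
          linarith
  refine le_trans (le_of_eq ?_) hfin
  congr 2
  refine Finset.filter_congr fun x hx => ?_
  rw [Finset.mem_inter] at hx
  rw [hfφ x hx.2 (hB hx.1), sub_ne_zero]

/-! ### Energies -/

section Energy
variable {G : Type*} [Fintype G]

lemma Ex_energy {p : ℝ} (σ : G → G → G)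
    (h1 : ∀ z (f : G → ℝ), ∑ w, f (σ w z) = ∑ x, f x)
    (h2 : ∀ w (f : G → ℝ), ∑ z, f (σ w z) = ∑ x, f x) {h : G → ℝ} (hh : ∀ x, 0 ≤ h x) :
    Ex p (fun A => ∑ w, (∑ z ∈ A, h (σ w z)) ^ 2) ≤
      p * (Fintype.card G * ∑ x, h x ^ 2) + p ^ 2 * (Fintype.card G * (∑ x, h x) ^ 2) := by
  have e : (fun A : Finset G => ∑ w, (∑ z ∈ A, h (σ w z)) ^ 2)
      = fun A => ∑ z ∈ A, ∑ z' ∈ A, ∑ w, h (σ w z) * h (σ w z') := by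
    ext A
    simp_rw [sq, Finset.sum_mul_sum]
    rw [Finset.sum_comm]
    refine Finset.sum_congr rfl fun z _ => ?_
    rw [Finset.sum_comm]
  rw [e]
  refine (Ex_quad _ (fun x y => Finset.sum_nonneg fun w _ => mul_nonneg (hh _) (hh _))).trans ?_
  refine le_of_eq ?_
  congr 2
  · have : ∀ x, ∑ w, h (σ w x) * h (σ w x) = ∑ x, h x ^ 2 := by
      intro x
      have := h1 x (fun y => h y ^ 2)
      simpa [sq] using this
    simp [this]
  · have e3 : ∑ x, ∑ y, ∑ w, h (σ w x) * h (σ w y) = ∑ w, (∑ x, h (σ w x)) * ∑ y, h (σ w y) := by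
      simp_rw [Finset.sum_mul_sum]
      rw [Finset.sum_comm]
      symm
      rw [Finset.sum_comm]
      simp_rw [fun y : G => Finset.sum_comm (s := Finset.univ) (t := Finset.univ) (f := fun (w : G) (i : G) => h (σ w y) * h (σ w i))]
      rw [Finset.sum_comm]
    rw [e3]
    simp_rw [h2]
    simp [sq]

variable [AddCommGroup G]

/-- number of representations `s = x + y`, `x ∈ A1`, `y ∈ A2`. -/
def rr (A1 A2 : Finset G) (s : G) : ℝ := ∑ y ∈ A2, ind (s - y ∈ A1)

/-- number of representations `w = x + y - z`. -/
def nn (A1 A2 A3 : Finset G) (w : G) : ℝ := ∑ z ∈ A3, rr A1 A2 (w + z)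

lemma rr_nonneg (A1 A2 : Finset G) (s : G) : 0 ≤ rr A1 A2 s :=
  Finset.sum_nonneg fun _ _ => ind_nonneg _

lemma nn_nonneg (A1 A2 A3 : Finset G) (s : G) : 0 ≤ nn A1 A2 A3 s :=
  Finset.sum_nonneg fun _ _ => rr_nonneg _ _ _

lemma sum_ind_mem (A : Finset G) : ∑ x, ind (x ∈ A) = A.card := by
  rw [← @card_filter_ind G Finset.univ (fun x => x ∈ A) (Classical.decPred _)]
  congr 2; ext; simp

lemma sum_rr (A1 A2 : Finset G) : ∑ s, rr A1 A2 s = A1.card * A2.card := by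
  unfold rr
  rw [Finset.sum_comm]
  have : ∀ y, ∑ x, ind (x - y ∈ A1) = A1.card := by
    intro y
    rw [← sum_ind_mem]
    exact Fintype.sum_equiv (Equiv.subRight y) _ _ (fun z => rfl)
  simp [this]; ring

lemma Ex_rr {p : ℝ} (A1 : Finset G) :
    Ex p (fun A2 => ∑ s, rr A1 A2 s ^ 2) ≤ p * (Fintype.card G * A1.card)
      + p ^ 2 * (Fintype.card G * (A1.card : ℝ) ^ 2) := by
  have := Ex_energy (p := p) (fun s y : G => s - y)
    (fun z f => Fintype.sum_equiv (Equiv.subRight z) _ _ (fun z => rfl))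
    (fun w f => Fintype.sum_equiv (Equiv.subLeft w) _ _ (fun z => rfl))
    (h := fun x => ind (x ∈ A1)) (fun x => ind_nonneg _)
  have e : ∀ x, ind (x ∈ A1) ^ 2 = ind (x ∈ A1) := by
    intro x; by_cases h : x ∈ A1 <;> simp [ind, h]
  simp_rw [e, sum_ind_mem] at this
  exact this

lemma Ex_nn {p : ℝ} (A1 A2 : Finset G) :
    Ex p (fun A3 => ∑ s, nn A1 A2 A3 s ^ 2) ≤ p * (Fintype.card G * ∑ s, rr A1 A2 s ^ 2)
      + p ^ 2 * (Fintype.card G * ((A1.card : ℝ) * A2.card) ^ 2) := by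
  have := Ex_energy (p := p) (fun s y : G => s + y)
    (fun z f => Fintype.sum_equiv (Equiv.addRight z) _ _ (fun z => rfl))
    (fun w f => Fintype.sum_equiv (Equiv.addLeft w) _ _ (fun z => rfl))
    (h := fun x => rr A1 A2 x) (fun x => rr_nonneg _ _ _)
  rw [sum_rr] at this
  exact this

lemma nn_eq (A1 A2 A3 : Finset G) (w : G) :
    nn A1 A2 A3 w = ∑ x ∈ A1, ∑ y ∈ A2, ∑ z ∈ A3, ind (x + y - z = w) := by
  unfold nn rr
  have : ∀ z y, ind (w + z - y ∈ A1) = ∑ x ∈ A1, ind (x + y - z = w) := by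
    intro z y
    have h : ∀ x, ind (x + y - z = w) = ind (x = w + z - y) := by
      intro x; apply ind_congr
      rw [sub_eq_iff_eq_add, eq_sub_iff_add_eq]
    simp_rw [h]
    simp [ind]
  simp_rw [this]
  rw [Finset.sum_comm]
  have e : ∀ y, ∑ z ∈ A3, ∑ x ∈ A1, ind (x + y - z = w) = ∑ x ∈ A1, ∑ z ∈ A3, ind (x + y - z = w) :=
    fun y => Finset.sum_comm
  simp_rw [e]
  rw [Finset.sum_comm]

/-- Cauchy-Schwarz for the set of sums covered by `F`. -/
lemma cs_hit (A1 A2 A3 : Finset G) (F : G → G → G → Prop) (W : Finset G)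
    (hW : ∀ x ∈ A1, ∀ y ∈ A2, ∀ z ∈ A3, F x y z → x + y - z ∈ W) :
    (∑ x ∈ A1, ∑ y ∈ A2, ∑ z ∈ A3, ind (F x y z)) ^ 2 ≤ W.card * ∑ w, nn A1 A2 A3 w ^ 2 := by
  have h1 : ∑ x ∈ A1, ∑ y ∈ A2, ∑ z ∈ A3, ind (F x y z) ≤ ∑ w ∈ W, nn A1 A2 A3 w := by
    have e : ∑ w ∈ W, nn A1 A2 A3 w = ∑ x ∈ A1, ∑ y ∈ A2, ∑ z ∈ A3, ∑ w ∈ W, ind (x + y - z = w) := by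
      simp_rw [nn_eq]
      rw [Finset.sum_comm]
      refine Finset.sum_congr rfl fun x _ => ?_
      rw [Finset.sum_comm]
      refine Finset.sum_congr rfl fun y _ => ?_
      rw [Finset.sum_comm]
    rw [e]
    refine Finset.sum_le_sum fun x hx => ?_
    refine Finset.sum_le_sum fun y hy => ?_
    refine Finset.sum_le_sum fun z hz => ?_
    by_cases h : F x y z
    · rw [ind_true h]
      have := Finset.single_le_sum (f := fun w => ind (x + y - z = w)) (fun w _ => ind_nonneg _)
        (hW x hx y hy z hz h)
      simpa [ind] using this
    · rw [ind_false h]; exact Finset.sum_nonneg fun _ _ => ind_nonneg _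
  have h0 : 0 ≤ ∑ x ∈ A1, ∑ y ∈ A2, ∑ z ∈ A3, ind (F x y z) :=
    Finset.sum_nonneg fun _ _ => Finset.sum_nonneg fun _ _ => Finset.sum_nonneg fun _ _ => ind_nonneg _
  calc _ ≤ (∑ w ∈ W, nn A1 A2 A3 w) ^ 2 := pow_le_pow_left₀ h0 h1 2
    _ ≤ W.card * ∑ w ∈ W, nn A1 A2 A3 w ^ 2 := sq_sum_le_card_mul_sum_sq
    _ ≤ _ := by
      gcongr
      exact Finset.subset_univ _

lemma cs_rr (A1 A2 : Finset G) (W : Finset G) (hW : ∀ x ∈ A1, ∀ y ∈ A2, x + y ∈ W) :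
    ((A1.card : ℝ) * A2.card) ^ 2 ≤ W.card * ∑ w, rr A1 A2 w ^ 2 := by
  have h1 : (A1.card : ℝ) * A2.card ≤ ∑ w ∈ W, rr A1 A2 w := by
    rw [← sum_rr]
    refine le_of_eq (Finset.sum_subset (Finset.subset_univ _) ?_).symm
    intro s _ hs
    refine Finset.sum_eq_zero fun y hy => ind_false fun h => hs ?_
    simpa using hW _ h _ hy
  calc _ ≤ (∑ w ∈ W, rr A1 A2 w) ^ 2 := pow_le_pow_left₀ (by positivity) h1 2
    _ ≤ W.card * ∑ w ∈ W, rr A1 A2 w ^ 2 := sq_sum_le_card_mul_sum_sq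
    _ ≤ _ := by
      gcongr
      exact Finset.subset_univ _

lemma Ex_zero {p : ℝ} : Ex (G := G) p (fun _ => 0) = 0 := Ex_const p 0

lemma Ex_le_one {p : ℝ} (h0 : 0 ≤ p) (h1 : p ≤ 1) {f : Finset G → ℝ} (h : ∀ A, f A ≤ 1) :
    Ex p f ≤ 1 := Ex_le_const h0 h1 h

lemma card_large {p L : ℝ} (h0 : 0 < p) (h1 : p ≤ 1) (hL : 0 < L) :
    Ex (G := G) p (fun A => ind (L * (p * Fintype.card G) < A.card)) ≤ 1 / L := by
  have hn : (0:ℝ) < Fintype.card G := by exact_mod_cast Fintype.card_pos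
  have := markov (G := G) h0.le h1 (f := fun A => (A.card : ℝ)) (fun A => by positivity)
    (l := L * (p * Fintype.card G)) (by positivity) (Ex_card p).le
  refine this.trans (le_of_eq ?_)
  field_simp

lemma rr_large {p L a : ℝ} (h0 : 0 < p) (h1 : p ≤ 1) (hL : 1 ≤ L) (ha : a = p * Fintype.card G)
    (ha2 : a ^ 2 ≤ Fintype.card G) (A1 : Finset G) (hA1 : (A1.card : ℝ) ≤ L * a) :
    Ex p (fun A2 => ind (2 * L ^ 3 * a ^ 2 < ∑ s, rr A1 A2 s ^ 2)) ≤ 1 / L := by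
  have hn : (0:ℝ) < Fintype.card G := by exact_mod_cast Fintype.card_pos
  set n : ℝ := (Fintype.card G : ℝ) with hn'
  have ha0 : 0 < a := by rw [ha]; positivity
  have hm : p * (n * A1.card) + p ^ 2 * (n * (A1.card : ℝ) ^ 2) ≤ 2 * L ^ 2 * a ^ 2 := by
    have e1 : p * (n * A1.card) = a * A1.card := by rw [ha]; ring
    have e2 : p ^ 2 * (n * (A1.card : ℝ) ^ 2) = p * a * (A1.card : ℝ) ^ 2 := by rw [ha]; ring
    have e3 : p * a ≤ 1 := by
      have : p * a * n ≤ 1 * n := by rw [one_mul]; refine le_trans (le_of_eq ?_) ha2; rw [ha]; ring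
      exact le_of_mul_le_mul_right this hn
    rw [e1, e2]
    have h3 : a * A1.card ≤ L ^ 2 * a ^ 2 := by
      have := mul_le_mul_of_nonneg_left hA1 ha0.le
      nlinarith [mul_nonneg (by linarith : 0 ≤ L - 1) (by positivity : 0 ≤ L * a ^ 2)]
    have h4 : p * a * (A1.card : ℝ) ^ 2 ≤ 1 * (L * a) ^ 2 := by
      gcongr
    nlinarith
  have := markov (G := G) h0.le h1 (f := fun A2 => ∑ s, rr A1 A2 s ^ 2)
    (fun A => Finset.sum_nonneg fun _ _ => sq_nonneg _)
    (l := 2 * L ^ 3 * a ^ 2) (by positivity) ((Ex_rr A1).trans hm)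
  refine this.trans (le_of_eq ?_)
  field_simp

/-- The pseudorandomness condition. -/
def goodA (L a : ℝ) (A1 A2 A3 : Finset G) : Prop :=
  (A1.card : ℝ) ≤ L * a ∧ (A2.card : ℝ) ≤ L * a ∧ (A3.card : ℝ) ≤ L * a ∧
    ∑ s, nn A1 A2 A3 s ^ 2 ≤ 3 * L ^ 5 * (a ^ 6 / Fintype.card G)

lemma nn_large {p L a : ℝ} (h0 : 0 < p) (h1 : p ≤ 1) (hL : 1 ≤ L) (ha : a = p * Fintype.card G)
    (ha3 : (Fintype.card G : ℝ) ≤ a ^ 3) (A1 A2 : Finset G)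
    (hA1 : (A1.card : ℝ) ≤ L * a) (hA2 : (A2.card : ℝ) ≤ L * a)
    (hE : ∑ s, rr A1 A2 s ^ 2 ≤ 2 * L ^ 3 * a ^ 2) :
    Ex p (fun A3 => ind (3 * L ^ 5 * (a ^ 6 / Fintype.card G) < ∑ s, nn A1 A2 A3 s ^ 2)) ≤ 1 / L := by
  have hn : (0:ℝ) < Fintype.card G := by exact_mod_cast Fintype.card_pos
  set n : ℝ := (Fintype.card G : ℝ) with hn'
  have ha0 : 0 < a := by rw [ha]; positivity
  have hm : p * (n * ∑ s, rr A1 A2 s ^ 2) + p ^ 2 * (n * ((A1.card : ℝ) * A2.card) ^ 2)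
      ≤ 3 * L ^ 4 * (a ^ 6 / n) := by
    have h3 : p * (n * ∑ s, rr A1 A2 s ^ 2) ≤ 2 * L ^ 4 * (a ^ 6 / n) := by
      have e1 : p * (n * ∑ s, rr A1 A2 s ^ 2) = a * ∑ s, rr A1 A2 s ^ 2 := by rw [ha]; ring
      rw [e1]
      calc _ ≤ a * (2 * L ^ 3 * a ^ 2) := by gcongr
        _ = 2 * L ^ 3 * 1 * (a ^ 3 * n / n) := by field_simp
        _ ≤ 2 * L ^ 3 * L * (a ^ 3 * a ^ 3 / n) := by gcongr
        _ = _ := by ring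
    have h4 : p ^ 2 * (n * ((A1.card : ℝ) * A2.card) ^ 2) ≤ L ^ 4 * (a ^ 6 / n) := by
      have q1 : (A1.card : ℝ) * A2.card ≤ (L * a) * (L * a) :=
        mul_le_mul hA1 hA2 (by positivity) (by positivity)
      have q2 := pow_le_pow_left₀ (by positivity) q1 2
      have q3 : 0 ≤ p ^ 2 * n := by positivity
      calc _ = p ^ 2 * n * ((A1.card : ℝ) * A2.card) ^ 2 := by rw [mul_assoc]
        _ ≤ p ^ 2 * n * ((L * a) * (L * a)) ^ 2 := mul_le_mul_of_nonneg_left q2 q3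
        _ = p ^ 2 * (n * ((L * a) * (L * a)) ^ 2) := by rw [mul_assoc]
        _ = (a / n) ^ 2 * (n * ((L * a) * (L * a)) ^ 2) := by
          have hp : p = a / n := by rw [ha]; field_simp
          rw [← hp]
        _ = _ := by clear_value n; clear ha; field_simp
    linarith
  have := markov (G := G) h0.le h1 (f := fun A3 => ∑ s, nn A1 A2 A3 s ^ 2)
    (fun A => Finset.sum_nonneg fun _ _ => sq_nonneg _)
    (l := 3 * L ^ 5 * (a ^ 6 / n)) (by positivity) ((Ex_nn A1 A2).trans hm)
  refine this.trans (le_of_eq ?_)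
  field_simp

lemma goodA_prob {p L a : ℝ} (h0 : 0 < p) (h1 : p ≤ 1) (hL : 1 ≤ L) (ha : a = p * Fintype.card G)
    (ha2 : a ^ 2 ≤ Fintype.card G) (ha3 : (Fintype.card G : ℝ) ≤ a ^ 3) :
    Ex (G := G) p (fun A1 => Ex p (fun A2 => Ex p (fun A3 => ind (¬ goodA L a A1 A2 A3)))) ≤ 5 / L := by
  have hL0 : 0 < L := by linarith
  have hL' : 0 ≤ 1 / L := by positivity
  have hcard : Ex (G := G) p (fun A => ind (L * a < A.card)) ≤ 1 / L := by
    rw [ha]; exact card_large h0 h1 hL0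
  have l1 : ∀ A1 A2 : Finset G, Ex p (fun A3 => ind (¬ goodA L a A1 A2 A3)) ≤ 1 :=
    fun A1 A2 => Ex_le_one h0.le h1 fun _ => ind_le_one _
  have l2 : ∀ A1 : Finset G, Ex p (fun A2 => Ex p (fun A3 => ind (¬ goodA L a A1 A2 A3))) ≤ 1 :=
    fun A1 => Ex_le_one h0.le h1 fun _ => l1 _ _
  have h5 : 5 / L = 1 / L + (2 / L + (2 / L + 0)) := by ring
  rw [h5]
  refine Ex_seq h0.le h1 (fun A1 => L * a < A1.card) (by positivity) l2 ?_ hcard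
  intro A1 hA1
  push Not at hA1
  refine Ex_seq h0.le h1 (fun A2 => L * a < A2.card ∨ 2 * L ^ 3 * a ^ 2 < ∑ s, rr A1 A2 s ^ 2)
    (by positivity) (l1 _) ?_ ?_
  swap
  · refine (Ex_mono h0.le h1 fun A => ind_or).trans ?_
    rw [Ex_add]
    have := rr_large h0 h1 hL ha ha2 A1 hA1
    have e : 2 / L = 1 / L + 1 / L := by ring
    linarith
  intro A2 hA2
  push Not at hA2
  refine Ex_seq h0.le h1 (fun A3 => L * a < A3.card ∨
    3 * L ^ 5 * (a ^ 6 / Fintype.card G) < ∑ s, nn A1 A2 A3 s ^ 2)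
    (le_refl 0) (fun _ => ind_le_one _) ?_ ?_
  swap
  · refine (Ex_mono h0.le h1 fun A => ind_or).trans ?_
    rw [Ex_add]
    have := nn_large h0 h1 hL ha ha3 A1 A2 hA1 hA2.1 hA2.2
    have e : 2 / L = 1 / L + 1 / L := by ring
    linarith
  intro A3 hA3
  push Not at hA3
  refine (ind_false ?_).le
  rw [not_not]
  exact ⟨hA1, hA2.1, hA3.1, hA3.2⟩

end Energy
/-! ### Hitting a dense set of triples -/

section Hit
variable {G : Type*} [Fintype G] [AddCommGroup G]

/-- no triple of `F` is detected. -/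
def nohit (F : G → G → G → Prop) (A1 A2 A3 B : Finset G) : Prop :=
  ∀ x ∈ A1, ∀ y ∈ A2, ∀ z ∈ A3, x + y - z ∈ B → ¬ F x y z

lemma sum_ind_le (A : Finset G) (P : G → Prop) : ∑ x ∈ A, ind (P x) ≤ A.card := by
  refine (Finset.sum_le_sum fun x _ => ind_le_one (P x)).trans ?_
  simp

lemma hit_B {pB L a η1 κ : ℝ} (h0 : 0 < pB) (h1 : pB ≤ 1) (ha : 0 < a) (hL : 1 ≤ L)
    (hη : 0 < η1) (hκ : κ ≤ η1 ^ 2 * (pB * Fintype.card G) / (12288 * L ^ 5))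
    (F : G → G → G → Prop) (A1 A2 A3 : Finset G) (hg : goodA L a A1 A2 A3)
    (hK : η1 * a ^ 3 / 64 ≤ ∑ x ∈ A1, ∑ y ∈ A2, ∑ z ∈ A3, ind (F x y z)) :
    Ex pB (fun B => ind (nohit F A1 A2 A3 B)) ≤ Real.exp (-κ) := by
  have hn : (0:ℝ) < Fintype.card G := by exact_mod_cast Fintype.card_pos
  let W : Finset G := Finset.univ.filter (fun w => ∃ x ∈ A1, ∃ y ∈ A2, ∃ z ∈ A3, F x y z ∧ x + y - z = w)
  have hW := cs_hit A1 A2 A3 F W (fun x hx y hy z hz hF => by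
    simp only [W, Finset.mem_filter, Finset.mem_univ, true_and]
    exact ⟨x, hx, y, hy, z, hz, hF, rfl⟩)
  have h2 : Ex pB (fun B => ind (nohit F A1 A2 A3 B)) ≤ Real.exp (- (pB * W.card)) := by
    refine le_trans (Ex_mono h0.le h1 fun B => ind_mono ?_) (miss h0.le h1 W)
    intro h x hx hxW
    simp only [W, Finset.mem_filter, Finset.mem_univ, true_and] at hxW
    obtain ⟨x', hx', y, hy, z, hz, hF, e⟩ := hxW
    exact h x' hx' y hy z hz (e ▸ hx) hF
  refine h2.trans (Real.exp_le_exp.2 (neg_le_neg (hκ.trans ?_)))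
  set n : ℝ := (Fintype.card G : ℝ)
  have h3 : (η1 * a ^ 3 / 64) ^ 2 ≤ W.card * (3 * L ^ 5 * (a ^ 6 / n)) := by
    refine (pow_le_pow_left₀ (by positivity) hK 2).trans (hW.trans ?_)
    exact mul_le_mul_of_nonneg_left hg.2.2.2 (by positivity)
  have h4 : η1 ^ 2 * n / (12288 * L ^ 5) ≤ W.card := by
    have e : W.card * (3 * L ^ 5 * (a ^ 6 / n)) = W.card * (3 * L ^ 5) * a ^ 6 / n := by ring
    rw [e, le_div_iff₀ hn] at h3
    rw [div_le_iff₀ (by positivity)]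
    have h5 : (η1 ^ 2 * n) * a ^ 6 ≤ (W.card * (12288 * L ^ 5)) * a ^ 6 := by nlinarith
    exact le_of_mul_le_mul_right h5 (by positivity)
  calc η1 ^ 2 * (pB * n) / (12288 * L ^ 5) = pB * (η1 ^ 2 * n / (12288 * L ^ 5)) := by ring
    _ ≤ _ := by gcongr

lemma Ex_ind_false {p : ℝ} {P : Finset G → Prop} (h : ∀ A, ¬ P A) : Ex p (fun A => ind (P A)) = 0 := by
  have : (fun A => ind (P A)) = fun _ => (0:ℝ) := funext fun A => ind_false (h A)
  rw [this, Ex_zero]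

lemma hit_prob {p pB L a η1 κ : ℝ} (h0 : 0 < p) (h1 : p ≤ 1) (h0B : 0 < pB) (h1B : pB ≤ 1)
    (hL : 1 ≤ L) (ha : a = p * Fintype.card G) (hη : 0 < η1)
    (hκ1 : κ ≤ η1 * a / (64 * L ^ 2))
    (hκ : κ ≤ η1 ^ 2 * (pB * Fintype.card G) / (12288 * L ^ 5))
    (F : G → G → G → Prop) (hF : η1 * (Fintype.card G : ℝ) ^ 3 ≤ ∑ x, ∑ y, ∑ z, ind (F x y z)) :
    Ex p (fun A1 => Ex p (fun A2 => Ex p (fun A3 => Ex pB (fun B =>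
      ind (goodA L a A1 A2 A3 ∧ nohit F A1 A2 A3 B))))) ≤ 4 * Real.exp (-κ) := by
  have hn : (0:ℝ) < Fintype.card G := by exact_mod_cast Fintype.card_pos
  set n : ℝ := (Fintype.card G : ℝ) with hn'
  have ha0 : 0 < a := by rw [ha]; positivity
  have hL0 : 0 < L := by linarith
  have hE := Real.exp_pos (-κ)
  have l0 : ∀ A1 A2 A3 : Finset G, Ex pB (fun B =>
      ind (goodA L a A1 A2 A3 ∧ nohit F A1 A2 A3 B)) ≤ 1 :=
    fun A1 A2 A3 => Ex_le_one h0B.le h1B fun _ => ind_le_one _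
  have l1 : ∀ A1 A2 : Finset G, Ex p (fun A3 => Ex pB (fun B =>
      ind (goodA L a A1 A2 A3 ∧ nohit F A1 A2 A3 B))) ≤ 1 :=
    fun A1 A2 => Ex_le_one h0.le h1 fun _ => l0 _ _ _
  have l2 : ∀ A1 : Finset G, Ex p (fun A2 => Ex p (fun A3 => Ex pB (fun B =>
      ind (goodA L a A1 A2 A3 ∧ nohit F A1 A2 A3 B)))) ≤ 1 :=
    fun A1 => Ex_le_one h0.le h1 fun _ => l1 _ _
  have e4 : 4 * Real.exp (-κ) = Real.exp (-κ) + (Real.exp (-κ) + (Real.exp (-κ) + Real.exp (-κ))) := by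
    ring
  rw [e4]
  -- stage 1
  have s1 := chernoff_lower (G := G) h0.le h1 (d := fun x => ∑ y, ∑ z, ind (F x y z)) (D := n ^ 2)
    (μ := η1 * a * n ^ 2) (by positivity)
    (fun x => Finset.sum_nonneg fun _ _ => Finset.sum_nonneg fun _ _ => ind_nonneg _)
    (fun x => by
      refine (Finset.sum_le_sum fun y _ => sum_ind_le _ _).trans ?_
      simp [← hn', sq])
    (by
      have := mul_le_mul_of_nonneg_left hF h0.le
      refine le_trans (le_of_eq ?_) this
      rw [ha]; ring)
  refine Ex_seq h0.le h1 _ (by positivity) l2 ?_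
    (s1.trans (Real.exp_le_exp.2 (neg_le_neg (hκ1.trans ?_))))
  swap
  · have : η1 * a * n ^ 2 / (4 * n ^ 2) = η1 * a / (4 * 1) := by field_simp
    rw [this]
    have : (1:ℝ) ≤ L ^ 2 := one_le_pow₀ hL
    gcongr
    linarith
  intro A1 hA1
  rw [not_lt] at hA1
  by_cases hc1 : (A1.card : ℝ) ≤ L * a
  swap
  · have : ∀ A2 A3 : Finset G, Ex pB (fun B => ind (goodA L a A1 A2 A3 ∧ nohit F A1 A2 A3 B)) = 0 :=
      fun A2 A3 => Ex_ind_false fun B h => hc1 h.1.1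
    simp_rw [this, Ex_zero]
    positivity
  -- stage 2
  have s2 := chernoff_lower (G := G) h0.le h1 (d := fun y => ∑ x ∈ A1, ∑ z, ind (F x y z)) (D := L * a * n)
    (μ := η1 * a ^ 2 * n / 4) (by positivity)
    (fun x => Finset.sum_nonneg fun _ _ => Finset.sum_nonneg fun _ _ => ind_nonneg _)
    (fun x => by
      refine (Finset.sum_le_sum fun y _ => sum_ind_le _ _).trans ?_
      simp only [Finset.sum_const, Finset.card_univ, nsmul_eq_mul, ← hn']
      gcongr)
    (by
      rw [Finset.sum_comm]
      have := mul_le_mul_of_nonneg_left hA1 h0.le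
      refine le_trans (le_of_eq ?_) this
      rw [ha]; ring)
  refine Ex_seq h0.le h1 _ (by positivity) (l1 _) ?_
    (s2.trans (Real.exp_le_exp.2 (neg_le_neg (hκ1.trans ?_))))
  swap
  · have : η1 * a ^ 2 * n / 4 / (4 * (L * a * n)) = η1 * a / (16 * L) := by field_simp; ring
    rw [this]
    gcongr
    · norm_num
    · nlinarith
  intro A2 hA2
  rw [not_lt] at hA2
  by_cases hc2 : (A2.card : ℝ) ≤ L * a
  swap
  · have : ∀ A3 : Finset G, Ex pB (fun B => ind (goodA L a A1 A2 A3 ∧ nohit F A1 A2 A3 B)) = 0 :=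
      fun A3 => Ex_ind_false fun B h => hc2 h.1.2.1
    simp_rw [this, Ex_zero]
    positivity
  -- stage 3
  have s3 := chernoff_lower (G := G) h0.le h1 (d := fun z => ∑ x ∈ A1, ∑ y ∈ A2, ind (F x y z)) (D := (L * a) * (L * a))
    (μ := η1 * a ^ 3 / 16) (by positivity)
    (fun x => Finset.sum_nonneg fun _ _ => Finset.sum_nonneg fun _ _ => ind_nonneg _)
    (fun x => by
      refine (Finset.sum_le_sum fun y _ => sum_ind_le _ _).trans ?_
      simp only [Finset.sum_const, nsmul_eq_mul]
      gcongr)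
    (by
      have e : ∑ z, ∑ x ∈ A1, ∑ y ∈ A2, ind (F x y z) = ∑ y ∈ A2, ∑ x ∈ A1, ∑ z, ind (F x y z) := by
        rw [Finset.sum_comm]
        rw [Finset.sum_comm (s := A2)]
        exact Finset.sum_congr rfl fun x _ => Finset.sum_comm
      rw [e]
      have := mul_le_mul_of_nonneg_left hA2 h0.le
      refine le_trans (le_of_eq ?_) this
      rw [ha]; ring)
  refine Ex_seq h0.le h1 _ (by positivity) (l0 _ _) ?_
    (s3.trans (Real.exp_le_exp.2 (neg_le_neg (hκ1.trans ?_))))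
  swap
  · refine le_of_eq ?_
    field_simp; ring
  intro A3 hA3
  rw [not_lt] at hA3
  by_cases hg : goodA L a A1 A2 A3
  swap
  · rw [Ex_ind_false fun B h => hg h.1]
    positivity
  refine (Ex_mono h0B.le h1B fun B => ind_mono fun h => h.2).trans ?_
  refine hit_B h0B h1B ha0 hL hη hκ F A1 A2 A3 hg ?_
  have e : ∑ z ∈ A3, ∑ x ∈ A1, ∑ y ∈ A2, ind (F x y z) = ∑ x ∈ A1, ∑ y ∈ A2, ∑ z ∈ A3, ind (F x y z) := by
    rw [Finset.sum_comm]
    exact Finset.sum_congr rfl fun x _ => Finset.sum_comm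
  rw [e] at hA3
  linarith

end Hit
/-! ### The set of points covered by `V + V - V` -/

section Cover
variable {G : Type*} [Fintype G] [AddCommGroup G]

/-- `w` is of the form `x + y - z`. -/
def cov (V1 V2 V3 : Finset G) (w : G) : Prop := ∃ x ∈ V1, ∃ y ∈ V2, ∃ z ∈ V3, x + y - z = w

/-- `V` is small and covers almost everything. -/
def goodV (m s : ℝ) (V : Finset G) : Prop :=
  (V.card : ℝ) ≤ m ∧ ∑ w, ind (¬ cov V V V w) ≤ s * Fintype.card G

lemma cov_mono {V1 V2 V3 V : Finset G} (h1 : V1 ⊆ V) (h2 : V2 ⊆ V) (h3 : V3 ⊆ V) {w : G}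
    (h : cov V1 V2 V3 w) : cov V V V w := by
  obtain ⟨x, hx, y, hy, z, hz, e⟩ := h
  exact ⟨x, h1 hx, y, h2 hy, z, h3 hz, e⟩

lemma card_small {p v : ℝ} (h0 : 0 ≤ p) (h1 : p ≤ 1) (hv : v ≤ p * Fintype.card G) :
    Ex (G := G) p (fun A => ind ((A.card : ℝ) < v / 4)) ≤ Real.exp (-(v / 4)) := by
  have := chernoff_lower (G := G) h0 h1 (d := fun _ => 1) (D := 1) (μ := v) one_pos
    (fun _ => zero_le_one) (fun _ => le_refl _) (by simpa using hv)
  simpa using this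

lemma cover_last {q L v s : ℝ} (h0 : 0 < q) (h1 : q ≤ 1) (hL : 1 ≤ L) (hv : 0 < v)
    (hs0 : 0 < s)
    (hs : L * Real.exp (-(q * v ^ 2 / (512 * L ^ 3))) ≤ s) (V1 V2 : Finset G)
    (hV1 : v / 4 ≤ V1.card) (hV2 : v / 4 ≤ V2.card)
    (hE : ∑ s, rr V1 V2 s ^ 2 ≤ 2 * L ^ 3 * v ^ 2) :
    Ex q (fun V3 => ind (s * Fintype.card G < ∑ w, ind (¬ cov V1 V2 V3 w))) ≤ 1 / L := by
  have hn : (0:ℝ) < Fintype.card G := by exact_mod_cast Fintype.card_pos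
  set n : ℝ := (Fintype.card G : ℝ) with hn'
  let W : Finset G := Finset.univ.filter (fun w => ∃ x ∈ V1, ∃ y ∈ V2, x + y = w)
  have hW := cs_rr V1 V2 W (fun x hx y hy => by
    simp only [W, Finset.mem_filter, Finset.mem_univ, true_and]
    exact ⟨x, hx, y, hy, rfl⟩)
  have hWc : v ^ 2 / (512 * L ^ 3) ≤ W.card := by
    have h3 : ((v / 4) * (v / 4)) ^ 2 ≤ W.card * (2 * L ^ 3 * v ^ 2) := by
      refine le_trans ?_ (hW.trans (mul_le_mul_of_nonneg_left hE (by positivity)))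
      gcongr
    rw [div_le_iff₀ (by positivity)]
    have : v ^ 2 * v ^ 2 ≤ (W.card * (512 * L ^ 3)) * v ^ 2 := by nlinarith
    exact le_of_mul_le_mul_right this (by positivity)
  have hw : ∀ w, Ex q (fun V3 => ind (¬ cov V1 V2 V3 w)) ≤ Real.exp (-(q * v ^ 2 / (512 * L ^ 3))) := by
    intro w
    let W' : Finset G := W.image (fun u => u - w)
    have hc : W'.card = W.card := Finset.card_image_of_injective _ (sub_left_injective)
    refine le_trans (Ex_mono h0.le h1 fun V3 => ind_mono ?_) ((miss h0.le h1 W').trans ?_)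
    · intro h z hz hzW
      simp only [W', W, Finset.mem_image, Finset.mem_filter, Finset.mem_univ, true_and] at hzW
      obtain ⟨u, ⟨x, hx, y, hy, rfl⟩, rfl⟩ := hzW
      exact h ⟨x, hx, y, hy, _, hz, by abel⟩
    · rw [hc]
      apply Real.exp_le_exp.2 (neg_le_neg _)
      calc q * v ^ 2 / (512 * L ^ 3) = q * (v ^ 2 / (512 * L ^ 3)) := by ring
        _ ≤ _ := by gcongr
  have hm : Ex q (fun V3 => ∑ w, ind (¬ cov V1 V2 V3 w)) ≤ n * Real.exp (-(q * v ^ 2 / (512 * L ^ 3))) := by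
    rw [Ex_sum]
    refine (Finset.sum_le_sum fun w _ => hw w).trans ?_
    simp [hn']
  refine (markov h0.le h1 (fun A => Finset.sum_nonneg fun _ _ => ind_nonneg _)
    (by positivity) hm).trans ?_
  rw [div_le_div_iff₀ (by positivity) (by linarith)]
  nlinarith

lemma cover_prob3 {q L v s : ℝ} (h0 : 0 < q) (h1 : q ≤ 1) (hL : 1 ≤ L) (hv : v = q * Fintype.card G)
    (hv2 : v ^ 2 ≤ Fintype.card G) (hx : Real.exp (-(v / 4)) ≤ 1 / L) (hs0 : 0 < s)
    (hs : L * Real.exp (-(q * v ^ 2 / (512 * L ^ 3))) ≤ s) :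
    Ex (G := G) q (fun V1 => Ex q (fun V2 => Ex q (fun V3 =>
      ind (¬ goodV (3 * (L * v)) s (V1 ∪ (V2 ∪ V3)))))) ≤ 7 / L := by
  have hn : (0:ℝ) < Fintype.card G := by exact_mod_cast Fintype.card_pos
  have hv0 : 0 < v := by rw [hv]; positivity
  have hL0 : 0 < L := by linarith
  have hL' : 0 ≤ 1 / L := by positivity
  have hcard : Ex (G := G) q (fun A => ind (L * v < A.card)) ≤ 1 / L := by
    rw [hv]; exact card_large h0 h1 hL0
  have hsm := (card_small (G := G) h0.le h1 hv.le).trans hx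
  have l1 : ∀ A1 A2 : Finset G, Ex q (fun A3 => ind (¬ goodV (3 * (L * v)) s (A1 ∪ (A2 ∪ A3)))) ≤ 1 :=
    fun A1 A2 => Ex_le_one h0.le h1 fun _ => ind_le_one _
  have l2 : ∀ A1 : Finset G, Ex q (fun A2 => Ex q (fun A3 => ind (¬ goodV (3 * (L * v)) s (A1 ∪ (A2 ∪ A3))))) ≤ 1 :=
    fun A1 => Ex_le_one h0.le h1 fun _ => l1 _ _
  have h5 : 7 / L = 2 / L + (3 / L + (2 / L + 0)) := by ring
  rw [h5]
  have e2 : 2 / L = 1 / L + 1 / L := by ring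
  have e3 : 3 / L = 1 / L + (1 / L + 1 / L) := by ring
  refine Ex_seq h0.le h1 (fun A1 => L * v < A1.card ∨ (A1.card : ℝ) < v / 4) (by positivity) l2 ?_ ?_
  swap
  · refine (Ex_mono h0.le h1 fun A => ind_or).trans ?_
    rw [Ex_add]; linarith
  intro A1 hA1
  push Not at hA1
  refine Ex_seq h0.le h1 (fun A2 => L * v < A2.card ∨ (A2.card : ℝ) < v / 4 ∨ 2 * L ^ 3 * v ^ 2 < ∑ s, rr A1 A2 s ^ 2)
    (by positivity) (l1 _) ?_ ?_
  swap
  · refine (Ex_mono h0.le h1 fun A => ind_or.trans (add_le_add_right ind_or _)).trans ?_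
    rw [Ex_add, Ex_add]
    have := rr_large h0 h1 hL hv hv2 A1 hA1.1
    linarith
  intro A2 hA2
  push Not at hA2
  refine Ex_seq h0.le h1 (fun A3 => L * v < A3.card ∨
    s * Fintype.card G < ∑ w, ind (¬ cov A1 A2 A3 w))
    (le_refl 0) (fun _ => ind_le_one _) ?_ ?_
  swap
  · refine (Ex_mono h0.le h1 fun A => ind_or).trans ?_
    rw [Ex_add]
    have := cover_last h0 h1 hL hv0 hs0 hs A1 A2 hA1.2 hA2.2.1 hA2.2.2
    linarith
  intro A3 hA3
  push Not at hA3
  refine (ind_false ?_).le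
  rw [not_not]
  refine ⟨?_, ?_⟩
  · have c1 : ((A1 ∪ (A2 ∪ A3)).card : ℝ) ≤ A1.card + (A2.card + A3.card) := by
      exact_mod_cast (Finset.card_union_le _ _).trans (Nat.add_le_add_left (Finset.card_union_le _ _) _)
    linarith [hA1.1, hA2.1, hA3.1]
  · refine le_trans (Finset.sum_le_sum fun w _ => ind_mono ?_) hA3.2
    exact fun h h' => h (cov_mono Finset.subset_union_left
      (Finset.subset_union_left.trans Finset.subset_union_right)
      (Finset.subset_union_right.trans Finset.subset_union_right) h')

lemma cover_prob {q L v s pV : ℝ} (h0 : 0 < q) (h1 : q ≤ 1) (hL : 1 ≤ L) (hv : v = q * Fintype.card G)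
    (hv2 : v ^ 2 ≤ Fintype.card G) (hx : Real.exp (-(v / 4)) ≤ 1 / L) (hs0 : 0 < s)
    (hs : L * Real.exp (-(q * v ^ 2 / (512 * L ^ 3))) ≤ s) (hpV : 1 - pV = (1 - q) ^ 3) :
    Ex (G := G) pV (fun V => ind (¬ goodV (3 * (L * v)) s V)) ≤ 7 / L := by
  have := cover_prob3 (G := G) h0 h1 hL hv hv2 hx hs0 hs
  rw [Ex_union (p1 := q) (p2 := 1 - (1 - q) ^ 2) (by rw [hpV]; ring)]
  have e : ∀ V1 : Finset G, Ex (1 - (1 - q) ^ 2) (fun A => ind (¬ goodV (3 * (L * v)) s (V1 ∪ A)))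
      = Ex q (fun V2 => Ex q (fun V3 => ind (¬ goodV (3 * (L * v)) s (V1 ∪ (V2 ∪ V3))))) := by
    intro V1
    rw [Ex_union (p1 := q) (p2 := q) (by ring)]
  simp_rw [e]
  exact this

end Cover
/-! ### The union bound -/

lemma exists_net {e : ℝ} (he : 0 < e) : ∃ N : Finset ℂ, (∀ u ∈ N, ‖u‖ = 1) ∧
    (∀ u : ℂ, ‖u‖ = 1 → ∃ w ∈ N, ‖u - w‖ ≤ e) := by
  have hc : IsCompact (Metric.sphere (0:ℂ) 1) := isCompact_sphere 0 1
  obtain ⟨t, ht, htf, hcov⟩ := hc.finite_cover_balls he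
  refine ⟨htf.toFinset, fun u hu => ?_, fun u hu => ?_⟩
  · have := ht (htf.mem_toFinset.1 hu)
    simpa using this
  · have hu' : u ∈ Metric.sphere (0:ℂ) 1 := by simpa using hu
    have := hcov hu'
    simp only [Set.mem_iUnion, Metric.mem_ball, exists_prop] at this
    obtain ⟨w, hw, hd⟩ := this
    refine ⟨w, htf.mem_toFinset.2 hw, ?_⟩
    rw [← dist_eq_norm]; exact hd.le

section Union
variable {G : Type*} [Fintype G]

/-- The finite set of net functions. -/
def netfuns (V : Finset G) (N : Finset ℂ) : Finset (G → ℂ) :=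
  Fintype.piFinset (fun x => if x ∈ V then N else {1})

lemma mem_netfuns {V : Finset G} {N : Finset ℂ} {θ : G → ℂ} : θ ∈ netfuns V N ↔ netfun V N θ := by
  unfold netfuns netfun
  rw [Fintype.mem_piFinset]
  refine forall_congr' fun x => ?_
  by_cases h : x ∈ V <;> simp [h]

lemma card_netfuns (V : Finset G) (N : Finset ℂ) : (netfuns V N).card = N.card ^ V.card := by
  unfold netfuns
  rw [Fintype.card_piFinset]
  have : ∀ x, (if x ∈ V then N else {1}).card = if x ∈ V then N.card else 1 := by
    intro x; split_ifs <;> simp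
  simp_rw [this]
  rw [Finset.prod_ite]; simp

lemma norm_netfun {V : Finset G} {N : Finset ℂ} {θ : G → ℂ} (hN1 : ∀ u ∈ N, ‖u‖ = 1)
    (h : netfun V N θ) (x : G) : ‖θ x‖ = 1 := by
  by_cases hx : x ∈ V
  · exact hN1 _ ((h x).1 hx)
  · rw [(h x).2 hx]; simp

/-- Expectation over four independent sets. -/
def E4 (p pB : ℝ) (f : Finset G → Finset G → Finset G → Finset G → ℝ) : ℝ :=
  Ex p (fun A1 => Ex p (fun A2 => Ex p (fun A3 => Ex pB (fun B => f A1 A2 A3 B))))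

lemma E4_mono {p pB : ℝ} (h0 : 0 ≤ p) (h1 : p ≤ 1) (h0B : 0 ≤ pB) (h1B : pB ≤ 1)
    {f g : Finset G → Finset G → Finset G → Finset G → ℝ} (h : ∀ A1 A2 A3 B, f A1 A2 A3 B ≤ g A1 A2 A3 B) :
    E4 p pB f ≤ E4 p pB g :=
  Ex_mono h0 h1 fun A1 => Ex_mono h0 h1 fun A2 => Ex_mono h0 h1 fun A3 => Ex_mono h0B h1B fun B =>
    h A1 A2 A3 B

lemma E4_add {p pB : ℝ} (f g : Finset G → Finset G → Finset G → Finset G → ℝ) :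
    E4 p pB (fun A1 A2 A3 B => f A1 A2 A3 B + g A1 A2 A3 B) = E4 p pB f + E4 p pB g := by
  unfold E4
  simp_rw [Ex_add]

lemma E4_sum {ι : Type*} (s : Finset ι) {p pB : ℝ} (f : ι → Finset G → Finset G → Finset G → Finset G → ℝ) :
    E4 p pB (fun A1 A2 A3 B => ∑ i ∈ s, f i A1 A2 A3 B) = ∑ i ∈ s, E4 p pB (f i) := by
  unfold E4
  simp_rw [Ex_sum]

lemma E4_B {p pB : ℝ} (f : Finset G → ℝ) : E4 p pB (fun _ _ _ B => f B) = Ex pB f := by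
  unfold E4
  simp_rw [Ex_const]

lemma E4_A {p pB : ℝ} (f : Finset G → Finset G → Finset G → ℝ) :
    E4 p pB (fun A1 A2 A3 _ => f A1 A2 A3) = Ex p (fun A1 => Ex p (fun A2 => Ex p (fun A3 => f A1 A2 A3))) := by
  unfold E4
  simp_rw [Ex_const]

lemma ind_exists {ι : Type*} (s : Finset ι) (P : ι → Prop) : ind (∃ i ∈ s, P i) ≤ ∑ i ∈ s, ind (P i) := by
  by_cases h : ∃ i ∈ s, P i
  · rw [ind_true h]
    obtain ⟨i, hi, hP⟩ := h
    have := Finset.single_le_sum (f := fun i => ind (P i)) (fun i _ => ind_nonneg (P i)) hi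
    rwa [ind_true hP] at this
  · rw [ind_false h]; exact Finset.sum_nonneg fun _ _ => ind_nonneg _

variable [AddCommGroup G]

/-- The set of triples whose derivative is far from `1`. -/
def badF (S : Finset G) (e : ℝ) (g : G → ℂ) (x y z : G) : Prop :=
  x ∈ S ∧ y ∈ S ∧ z ∈ S ∧ x + y - z ∈ S ∧ 12 * e < ‖quadv g x y z - 1‖

/-- The first exceptional event. -/
def ev1 (L a η1 e : ℝ) (V S : Finset G) (N : Finset ℂ) (ra rb rc : G → G) (A1 A2 A3 B : Finset G) : Prop :=
  ∃ θ ∈ netfuns V N,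
    η1 * (Fintype.card G : ℝ) ^ 3 < ∑ x, ∑ y, ∑ z, ind (badF S e (gfun ra rb rc θ) x y z) ∧
    goodA L a A1 A2 A3 ∧ nohit (badF S e (gfun ra rb rc θ)) A1 A2 A3 B

lemma ev1_prob {p pB L a η1 κ e K : ℝ} (h0 : 0 < p) (h1 : p ≤ 1) (h0B : 0 < pB) (h1B : pB ≤ 1)
    (hL : 1 ≤ L) (ha : a = p * Fintype.card G) (hη : 0 < η1)
    (hκ1 : κ ≤ η1 * a / (64 * L ^ 2))
    (hκ : κ ≤ η1 ^ 2 * (pB * Fintype.card G) / (12288 * L ^ 5))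
    (V S : Finset G) (N : Finset ℂ) (ra rb rc : G → G) (hK : (N.card : ℝ) ^ V.card ≤ K) :
    E4 p pB (fun A1 A2 A3 B => ind (ev1 L a η1 e V S N ra rb rc A1 A2 A3 B)) ≤ K * (4 * Real.exp (-κ)) := by
  refine (E4_mono h0.le h1 h0B.le h1B fun A1 A2 A3 B => ind_exists _ _).trans ?_
  rw [E4_sum]
  have hE := Real.exp_pos (-κ)
  have : ∀ θ ∈ netfuns V N, E4 p pB (fun A1 A2 A3 B => ind (
    η1 * (Fintype.card G : ℝ) ^ 3 < ∑ x, ∑ y, ∑ z, ind (badF S e (gfun ra rb rc θ) x y z) ∧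
    goodA L a A1 A2 A3 ∧ nohit (badF S e (gfun ra rb rc θ)) A1 A2 A3 B)) ≤ 4 * Real.exp (-κ) := by
    intro θ _
    by_cases h : η1 * (Fintype.card G : ℝ) ^ 3 < ∑ x, ∑ y, ∑ z, ind (badF S e (gfun ra rb rc θ) x y z)
    · refine le_trans (E4_mono h0.le h1 h0B.le h1B fun A1 A2 A3 B => ind_mono fun h => h.2) ?_
      exact hit_prob h0 h1 h0B h1B hL ha hη hκ1 hκ _ h.le
    · refine le_trans (E4_mono h0.le h1 h0B.le h1B fun A1 A2 A3 B => (ind_false fun h' => h h'.1).le) ?_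
      rw [E4_B (fun _ => 0), Ex_const]; positivity
  refine (Finset.sum_le_sum this).trans ?_
  rw [Finset.sum_const, card_netfuns, nsmul_eq_mul]
  push_cast
  gcongr

/-- The second exceptional event. -/
def ev2 (pB s2 : ℝ) (V : Finset G) (N : Finset ℂ) (ra rb rc : G → G) (B : Finset G) : Prop :=
  ∃ i ∈ (netfuns V N ×ˢ (N ×ˢ (Finset.univ : Finset (AddChar G ℂ)))),
    2 * (pB * ∑ x, ‖gfun ra rb rc i.1 x - i.2.1 * i.2.2 x‖) + s2 <
      ∑ x ∈ B, ‖gfun ra rb rc i.1 x - i.2.1 * i.2.2 x‖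

lemma ev2_prob {pB s2 K : ℝ} (h0B : 0 < pB) (h1B : pB ≤ 1)
    (V : Finset G) (N : Finset ℂ) (hN1 : ∀ u ∈ N, ‖u‖ = 1) (ra rb rc : G → G)
    (hK : (N.card : ℝ) ^ V.card ≤ K) :
    Ex pB (fun B => ind (ev2 pB s2 V N ra rb rc B)) ≤
      K * (N.card * Fintype.card G * Real.exp (-(s2 / 2))) := by
  refine (Ex_mono h0B.le h1B fun B => ind_exists _ _).trans ?_
  rw [Ex_sum]
  have : ∀ i ∈ (netfuns V N ×ˢ (N ×ˢ (Finset.univ : Finset (AddChar G ℂ)))),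
      Ex pB (fun B => ind (2 * (pB * ∑ x, ‖gfun ra rb rc i.1 x - i.2.1 * i.2.2 x‖) + s2 <
      ∑ x ∈ B, ‖gfun ra rb rc i.1 x - i.2.1 * i.2.2 x‖)) ≤ Real.exp (-(s2 / 2)) := by
    rintro ⟨θ, c, γ⟩ hi
    simp only [Finset.mem_product, Finset.mem_univ, and_true] at hi
    obtain ⟨hθ, hc⟩ := hi
    simp only
    have hb : ∀ x, ‖gfun ra rb rc θ x - c * γ x‖ / 2 ≤ 1 := by
      intro x
      have h1 := norm_sub_le (gfun ra rb rc θ x) (c * γ x)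
      rw [norm_gfun (norm_netfun hN1 (mem_netfuns.1 hθ)), norm_mul, hN1 c hc, AddChar.norm_apply] at h1
      linarith
    have := chernoff_upper h0B.le h1B (d := fun x => ‖gfun ra rb rc θ x - c * γ x‖ / 2)
      (fun x => by positivity) hb (s2 / 2)
    refine le_trans (Ex_mono h0B.le h1B fun B => ind_mono fun h => ?_) this
    rw [← Finset.sum_div, ← Finset.sum_div]
    linarith
  refine (Finset.sum_le_sum this).trans ?_
  rw [Finset.sum_const, nsmul_eq_mul, Finset.card_product, Finset.card_product, card_netfuns,
    Finset.card_univ, AddChar.card_eq]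
  push_cast
  rw [mul_assoc, mul_assoc]
  gcongr

end Union
/-! ### Assembly -/

/-- The conclusion of the theorem for a given set. -/
def Good {G : Type} [AddCommGroup G] (ε : ℝ) (U : Finset G) : Prop :=
  ∀ (H : Type) [AddCommGroup H] [AddGroup.FG H] (φ : G → H), FreimanHomOn U φ →
    ∃ (ψ : G →+ H) (c : H), ((U.filter fun x => ¬ φ x = ψ x + c).card : ℝ) ≤ ε * U.card

lemma main_V {G : Type} [Fintype G] [AddCommGroup G] {p pB L a b η η1 κ e K s s2 m ε : ℝ}
    (h0 : 0 < p) (h1 : p ≤ 1) (h0B : 0 < pB) (h1B : pB ≤ 1)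
    (hL : 1 ≤ L) (ha : a = p * Fintype.card G) (hb : b = pB * Fintype.card G) (hη1 : 0 < η1)
    (ha2 : a ^ 2 ≤ Fintype.card G) (ha3 : (Fintype.card G : ℝ) ≤ a ^ 3)
    (hκ1 : κ ≤ η1 * a / (64 * L ^ 2))
    (hκ : κ ≤ η1 ^ 2 * b / (12288 * L ^ 5)) (hs : 0 < s) (he : 0 ≤ e) (hε : 0 ≤ ε)
    (N : Finset ℂ) (hN1 : ∀ u ∈ N, ‖u‖ = 1) (hN : ∀ u : ℂ, ‖u‖ = 1 → ∃ w ∈ N, ‖u - w‖ ≤ e)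
    (V : Finset G) (hV : goodV m s V) (hK : (N.card : ℝ) ^ V.card ≤ K)
    (hη : 2 * η1 + 8 * s + 24 * e < η / 2) (hη6 : η < 1 / 6) (hη0 : 0 < η)
    (hfin : m + 3 * (L * a) + L * s * b + 2 * b * (4 * η + 4 * e + 2 * s) + s2 + 4 * e * (L * b)
      ≤ ε * (b / 4)) :
    E4 p pB (fun A1 A2 A3 B => ind (¬ Good ε (V ∪ (A1 ∪ (A2 ∪ (A3 ∪ B)))))) ≤
      7 / L + K * (4 * Real.exp (-κ)) + K * (N.card * Fintype.card G * Real.exp (-(s2 / 2)))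
        + Real.exp (-(b / 4)) := by
  have hn : (0:ℝ) < Fintype.card G := by exact_mod_cast Fintype.card_pos
  have hL0 : 0 < L := by linarith
  have hb0 : 0 < b := by rw [hb]; positivity
  let S : Finset G := Finset.univ.filter (fun w => cov V V V w)
  have hScov : ∀ w ∈ S, ∃ t : G × G × G, t.1 ∈ V ∧ t.2.1 ∈ V ∧ t.2.2 ∈ V ∧ t.1 + t.2.1 - t.2.2 = w := by
    intro w hw
    simp only [S, Finset.mem_filter, Finset.mem_univ, true_and] at hw
    obtain ⟨x, hx, y, hy, z, hz, e⟩ := hw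
    exact ⟨(x, y, z), hx, hy, hz, e⟩
  have : ∀ w, ∃ t : G × G × G, w ∈ S → (t.1 ∈ V ∧ t.2.1 ∈ V ∧ t.2.2 ∈ V ∧ t.1 + t.2.1 - t.2.2 = w) := by
    intro w
    by_cases hw : w ∈ S
    · obtain ⟨t, ht⟩ := hScov w hw
      exact ⟨t, fun _ => ht⟩
    · exact ⟨0, fun h => absurd h hw⟩
  choose r hr using this
  let ra : G → G := fun x => (r x).1
  let rb : G → G := fun x => (r x).2.1
  let rc : G → G := fun x => (r x).2.2
  have hSc : ∑ x, ind (x ∉ S) ≤ s * Fintype.card G := by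
    refine le_trans (Finset.sum_le_sum fun x _ => ind_mono ?_) hV.2
    intro h h'
    exact h (by simp [S, h'])
  have hScard : ((Sᶜ).card : ℝ) ≤ s * Fintype.card G := by
    refine le_trans (le_of_eq ?_) hSc
    rw [← sum_ind_mem]
    exact Finset.sum_congr rfl fun x _ => ind_congr Finset.mem_compl
  -- the deterministic part
  have hdet : ∀ A1 A2 A3 B : Finset G, ¬ Good ε (V ∪ (A1 ∪ (A2 ∪ (A3 ∪ B)))) →
      (¬ goodA L a A1 A2 A3) ∨ ev1 L a η1 e V S N ra rb rc A1 A2 A3 B ∨ ev2 pB s2 V N ra rb rc B ∨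
        L * b < B.card ∨ L * (s * b) < ∑ x ∈ B, ind (x ∉ S) ∨ (B.card : ℝ) < b / 4 := by
    intro A1 A2 A3 B
    contrapose!
    rintro ⟨hgA, he1, he2, hB1, hB2, hB3⟩
    intro H _ _ φ hφ
    set U := V ∪ (A1 ∪ (A2 ∪ (A3 ∪ B))) with hU
    have sV : V ⊆ U := Finset.subset_union_left
    have sA1 : A1 ⊆ U := Finset.subset_union_left.trans Finset.subset_union_right
    have sA2 : A2 ⊆ U := (Finset.subset_union_left.trans Finset.subset_union_right).trans Finset.subset_union_right
    have sAB : A3 ∪ B ⊆ U := (Finset.subset_union_right.trans Finset.subset_union_right).trans Finset.subset_union_right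
    have sA3 : A3 ⊆ U := Finset.subset_union_left.trans sAB
    have sB : B ⊆ U := Finset.subset_union_right.trans sAB
    obtain ⟨ψ, c, hψ⟩ := det (s2 := s2) (η1 := η1) (p := pB) sV sA1 sA2 sA3 sB (S := S) (ra := ra) (rb := rb) (rc := rc)
      (fun x hx => hr x hx) hN1 hN he h0B.le hScard
      (by
        intro θ hθ h
        by_contra hc
        push Not at hc
        exact he1 ⟨θ, mem_netfuns.2 hθ, hc, hgA, fun x hx y hy z hz hw hF =>
          absurd (h x hx y hy z hz hw hF.1 hF.2.1 hF.2.2.1 hF.2.2.2.1) (not_le.2 hF.2.2.2.2)⟩)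
      (by
        intro θ hθ c hc γ
        by_contra hcon
        push Not at hcon
        exact he2 ⟨(θ, c, γ), by simp [mem_netfuns.2 hθ, hc], hcon⟩)
      hη hη6 hη0 φ hφ
    refine ⟨ψ, c, ?_⟩
    have hsub : U.filter (fun x => ¬ φ x = ψ x + c) ⊆ V ∪ (A1 ∪ (A2 ∪ (A3 ∪
        (B.filter (fun x => x ∉ S) ∪ (B ∩ S).filter (fun x => φ x ≠ ψ x + c))))) := by
      intro x hx
      simp only [hU, Finset.mem_filter, Finset.mem_union, Finset.mem_inter] at hx ⊢
      tauto
    have hc1 := (Finset.card_le_card hsub).trans (Finset.card_union_le _ _)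
    have hc2 := Finset.card_union_le A1 (A2 ∪ (A3 ∪
        (B.filter (fun x => x ∉ S) ∪ (B ∩ S).filter (fun x => φ x ≠ ψ x + c))))
    have hc3 := Finset.card_union_le A2 (A3 ∪
        (B.filter (fun x => x ∉ S) ∪ (B ∩ S).filter (fun x => φ x ≠ ψ x + c)))
    have hc4 := Finset.card_union_le A3
        (B.filter (fun x => x ∉ S) ∪ (B ∩ S).filter (fun x => φ x ≠ ψ x + c))
    have hc5 := Finset.card_union_le
        (B.filter (fun x => x ∉ S)) ((B ∩ S).filter (fun x => φ x ≠ ψ x + c))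
    have hc : ((U.filter (fun x => ¬ φ x = ψ x + c)).card : ℝ) ≤ V.card + A1.card + A2.card + A3.card
        + (B.filter (fun x => x ∉ S)).card + ((B ∩ S).filter (fun x => φ x ≠ ψ x + c)).card := by
      have hcn : (U.filter (fun x => ¬ φ x = ψ x + c)).card ≤ V.card + A1.card + A2.card + A3.card
        + (B.filter (fun x => x ∉ S)).card + ((B ∩ S).filter (fun x => φ x ≠ ψ x + c)).card := by
        omega
      have := (Nat.cast_le (α := ℝ)).2 hcn
      simp only [Nat.cast_add] at this
      exact this
    rw [card_filter_ind B (fun x => x ∉ S)] at hc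
    have hUB : (B.card : ℝ) ≤ U.card := by exact_mod_cast Finset.card_le_card sB
    have hε1 : ε * (b / 4) ≤ ε * U.card := mul_le_mul_of_nonneg_left (hB3.trans hUB) hε
    have e1 : 2 * pB * ((4 * η + 4 * e + 2 * s) * Fintype.card G) = 2 * b * (4 * η + 4 * e + 2 * s) := by
      rw [hb]; ring
    rw [e1] at hψ
    have e2 : 4 * e * B.card ≤ 4 * e * (L * b) := mul_le_mul_of_nonneg_left hB1 (by positivity)
    linarith [hV.1, hgA.1, hgA.2.1, hgA.2.2.1]
  -- probabilities
  have q1 := goodA_prob (G := G) h0 h1 hL ha ha2 ha3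
  have q2 := ev1_prob (e := e) h0 h1 h0B h1B hL ha hη1 hκ1 (hb ▸ hκ) V S N ra rb rc hK
  have q3 := ev2_prob (s2 := s2) h0B h1B V N hN1 ra rb rc hK
  have q4 : Ex (G := G) pB (fun A => ind (L * b < A.card)) ≤ 1 / L := by
    rw [hb]; exact card_large h0B h1B hL0
  have q5 : Ex (G := G) pB (fun B => ind (L * (s * b) < ∑ x ∈ B, ind (x ∉ S))) ≤ 1 / L := by
    have := markov (G := G) h0B.le h1B (f := fun B => ∑ x ∈ B, ind (x ∉ S)) (m := s * b)
      (l := L * (s * b)) (fun B => Finset.sum_nonneg fun _ _ => ind_nonneg _) (by positivity) (by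
        rw [Ex_lin, hb]
        have := mul_le_mul_of_nonneg_left hSc h0B.le
        linarith)
    refine this.trans (le_of_eq ?_)
    field_simp
  have q6 := card_small (G := G) h0B.le h1B hb.le
  have hle : E4 p pB (fun A1 A2 A3 B => ind (¬ Good ε (V ∪ (A1 ∪ (A2 ∪ (A3 ∪ B)))))) ≤
      E4 p pB (fun A1 A2 A3 B => ind (¬ goodA L a A1 A2 A3) +
        (ind (ev1 L a η1 e V S N ra rb rc A1 A2 A3 B) + (ind (ev2 pB s2 V N ra rb rc B) +
        (ind (L * b < B.card) + (ind (L * (s * b) < ∑ x ∈ B, ind (x ∉ S)) + ind ((B.card : ℝ) < b / 4)))))) := by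
    refine E4_mono h0.le h1 h0B.le h1B fun A1 A2 A3 B => ?_
    refine (ind_mono (hdet A1 A2 A3 B)).trans ?_
    refine ind_or.trans (add_le_add_right ?_ _)
    refine ind_or.trans (add_le_add_right ?_ _)
    refine ind_or.trans (add_le_add_right ?_ _)
    refine ind_or.trans (add_le_add_right ?_ _)
    exact ind_or
  refine hle.trans ?_
  rw [E4_add, E4_add, E4_A, E4_B (fun B => ind (ev2 pB s2 V N ra rb rc B) +
        (ind (L * b < B.card) + (ind (L * (s * b) < ∑ x ∈ B, ind (x ∉ S)) + ind ((B.card : ℝ) < b / 4)))),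
    Ex_add, Ex_add, Ex_add]
  have e7 : 7 / L = 5 / L + 1 / L + 1 / L := by ring
  linarith

lemma main_all {G : Type} [Fintype G] [AddCommGroup G] {p0 pV q p pB L a b v η η1 κ e K s s2 ε : ℝ}
    (h0 : 0 < p) (h1 : p ≤ 1) (h0B : 0 < pB) (h1B : pB ≤ 1) (h0q : 0 < q) (h1q : q ≤ 1)
    (hp0 : 1 - p0 = (1 - pV) * ((1 - p) * ((1 - p) * ((1 - p) * (1 - pB)))))
    (hpV : 1 - pV = (1 - q) ^ 3)
    (hL : 1 ≤ L) (ha : a = p * Fintype.card G) (hb : b = pB * Fintype.card G)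
    (hv : v = q * Fintype.card G)
    (hv2 : v ^ 2 ≤ Fintype.card G) (hx : Real.exp (-(v / 4)) ≤ 1 / L)
    (hsx : L * Real.exp (-(q * v ^ 2 / (512 * L ^ 3))) ≤ s)
    (hη1 : 0 < η1)
    (ha2 : a ^ 2 ≤ Fintype.card G) (ha3 : (Fintype.card G : ℝ) ≤ a ^ 3)
    (hκ1 : κ ≤ η1 * a / (64 * L ^ 2))
    (hκ : κ ≤ η1 ^ 2 * b / (12288 * L ^ 5)) (hs : 0 < s) (he : 0 ≤ e) (hε : 0 ≤ ε)
    (N : Finset ℂ) (hN1 : ∀ u ∈ N, ‖u‖ = 1) (hN : ∀ u : ℂ, ‖u‖ = 1 → ∃ w ∈ N, ‖u - w‖ ≤ e)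
    (hK0 : 0 ≤ K) (hK : ∀ j : ℕ, (j : ℝ) ≤ 3 * (L * v) → (N.card : ℝ) ^ j ≤ K)
    (hη : 2 * η1 + 8 * s + 24 * e < η / 2) (hη6 : η < 1 / 6) (hη0 : 0 < η)
    (hfin : 3 * (L * v) + 3 * (L * a) + L * s * b + 2 * b * (4 * η + 4 * e + 2 * s) + s2 + 4 * e * (L * b)
      ≤ ε * (b / 4)) :
    Ex (G := G) p0 (fun U => ind (¬ Good ε U)) ≤
      7 / L + (7 / L + K * (4 * Real.exp (-κ)) + K * (N.card * Fintype.card G * Real.exp (-(s2 / 2)))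
        + Real.exp (-(b / 4))) := by
  have hL0 : 0 < L := by linarith
  have hV0 : 0 ≤ pV := by
    have : (1 - q) ^ 3 ≤ 1 := pow_le_one₀ (by linarith) (by linarith)
    linarith
  have hV1 : pV ≤ 1 := by
    have : 0 ≤ (1 - q) ^ 3 := pow_nonneg (by linarith) 3
    linarith
  have key : Ex (G := G) p0 (fun U => ind (¬ Good ε U)) = Ex (G := G) pV (fun V : Finset G => E4 p pB (fun A1 A2 A3 B : Finset G =>
      ind (¬ Good ε (V ∪ (A1 ∪ (A2 ∪ (A3 ∪ B))))))) := by
    rw [Ex_union (p1 := pV) (p2 := 1 - ((1 - p) * ((1 - p) * ((1 - p) * (1 - pB))))) (by rw [hp0]; ring)]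
    congr 1; ext V
    unfold E4
    rw [Ex_union (p1 := p) (p2 := 1 - ((1 - p) * ((1 - p) * (1 - pB)))) (by ring)]
    congr 1; ext A1
    rw [Ex_union (p1 := p) (p2 := 1 - ((1 - p) * (1 - pB))) (by ring)]
    congr 1; ext A2
    rw [Ex_union (p1 := p) (p2 := pB) (by ring)]
  rw [key]
  refine Ex_seq hV0 hV1 (fun V => ¬ goodV (3 * (L * v)) s V) (by positivity) ?_ ?_
    (cover_prob h0q h1q hL hv hv2 hx hs hsx hpV)
  · intro V
    refine (E4_mono h0.le h1 h0B.le h1B fun A1 A2 A3 B => ind_le_one _).trans ?_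
    rw [E4_B (fun _ => 1), Ex_const]
  · intro V hV
    rw [not_not] at hV
    exact main_V h0 h1 h0B h1B hL ha hb hη1 ha2 ha3 hκ1 hκ hs he hε N hN1 hN V hV (hK _ hV.1)
      hη hη6 hη0 hfin

lemma exp_neg_le_inv {x : ℝ} (hx : 0 < x) : Real.exp (-x) ≤ 1 / x := by
  rw [Real.exp_neg, ← one_div]
  exact one_div_le_one_div_of_le hx (by linarith [Real.add_one_le_exp x])

set_option maxHeartbeats 4000000 in
lemma main_const {ε δ : ℝ} (hε : 0 < ε) (hε1 : ε ≤ 1) (hδ : 0 < δ) (hδ1 : δ ≤ 1) :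
    ∃ R : ℝ, 1 ≤ R ∧ ∀ (G : Type) [AddCommGroup G] [Fintype G] (t p : ℝ), 0 < t →
      t ^ 3 = Fintype.card G → 0 < p → p ≤ 1 → R * t ≤ p * Fintype.card G →
      (p * Fintype.card G) ^ 2 ≤ Fintype.card G → R * (1 + Real.log (Fintype.card G)) ≤ t →
      Ex (G := G) p (fun U => ind (¬ Good ε U)) ≤ δ := by
  obtain ⟨L, hLdef⟩ : ∃ L, L = 20 / δ := ⟨_, rfl⟩
  have hL : 1 ≤ L := by rw [hLdef, le_div_iff₀ hδ]; linarith
  have hL0 : 0 < L := by linarith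
  obtain ⟨η, hηd⟩ : ∃ η, η = ε / 400 := ⟨_, rfl⟩
  have hη0 : 0 < η := by rw [hηd]; positivity
  obtain ⟨s, hsd⟩ : ∃ s, s = η / (100 * L) := ⟨_, rfl⟩
  have hs0 : 0 < s := by rw [hsd]; positivity
  have hLs : L * s = η / 100 := by rw [hsd]; field_simp
  have hsη : s ≤ η / 100 := by rw [← hLs]; nlinarith
  obtain ⟨η1, heta_d⟩ : ∃ η1, η1 = η / 100 := ⟨_, rfl⟩
  have hη10 : 0 < η1 := by rw [heta_d]; positivity
  have hη11 : η1 ≤ 1 := by rw [heta_d, hηd]; linarith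
  obtain ⟨τ, hτd⟩ : ∃ τ, τ = ε / (144 * L) := ⟨_, rfl⟩
  have hτ0 : 0 < τ := by rw [hτd]; positivity
  have hLτ : L * τ = ε / 144 := by rw [hτd]; field_simp
  have hτ1 : τ ≤ 1 / 144 := by nlinarith
  obtain ⟨M, hMd⟩ : ∃ M, M = 1 + 512 * L ^ 4 / s := ⟨_, rfl⟩
  have hM1 : 1 ≤ M := by rw [hMd]; have : 0 ≤ 512 * L ^ 4 / s := by positivity
                         linarith
  have hM0 : 0 < M := by linarith
  have hMs : L * (512 * L ^ 3) ≤ M ^ 3 * s := by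
    have h1 : M * s ≥ 512 * L ^ 4 := by
      rw [hMd, add_mul, div_mul_cancel₀ _ hs0.ne']; linarith
    have h2 : M ≤ M ^ 3 := le_self_pow₀ hM1 (by norm_num)
    nlinarith
  obtain ⟨N, hN1, hN⟩ := exists_net hs0
  obtain ⟨k, hk⟩ : ∃ k : ℝ, k = N.card := ⟨_, rfl⟩
  have hk0 : 0 ≤ k := by rw [hk]; positivity
  obtain ⟨c0, hc0d⟩ : ∃ c0, c0 = η1 ^ 2 * τ / (24576 * L ^ 5) := ⟨_, rfl⟩
  have hc00 : 0 < c0 := by rw [hc0d]; positivity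
  obtain ⟨R, hRd⟩ : ∃ R, R = 8 + 4 * L + M ^ 2 + 1 / τ + 12 * M + 144 * L * M / ε
    + (3 * k * L * M + 1) / c0 + 96 * (3 * k * L * M + k + 2) / ε := ⟨_, rfl⟩
  have t1 : 0 ≤ 1 / τ := by positivity
  have t2 : 0 ≤ 144 * L * M / ε := by positivity
  have t3 : 0 ≤ (3 * k * L * M + 1) / c0 := by positivity
  have t4 : 0 ≤ 96 * (3 * k * L * M + k + 2) / ε := by positivity
  have t5 : 0 ≤ M ^ 2 := by positivity
  have R1 : 8 ≤ R := by linarith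
  have R2 : 4 * L ≤ R := by linarith
  have R3 : M ^ 2 ≤ R := by linarith
  have R4 : 1 ≤ τ * R := by
    have h : 1 / τ ≤ R := by linarith
    rw [div_le_iff₀ hτ0] at h; linarith
  have R5 : 12 * M ≤ R := by linarith
  have R6 : 144 * L * M ≤ ε * R := by
    have h : 144 * L * M / ε ≤ R := by linarith
    rw [div_le_iff₀ hε] at h; linarith
  have R7 : 3 * k * L * M + 1 ≤ c0 * R := by
    have h : (3 * k * L * M + 1) / c0 ≤ R := by linarith
    rw [div_le_iff₀ hc00] at h; linarith
  have R8 : 96 * (3 * k * L * M + k + 2) ≤ ε * R := by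
    have h : 96 * (3 * k * L * M + k + 2) / ε ≤ R := by linarith
    rw [div_le_iff₀ hε] at h; linarith
  refine ⟨R, by linarith, ?_⟩
  clear hRd t1 t2 t3 t4 t5
  intro G _ _ t p ht htn hp hp1 hRP hP2 hlog
  have hn1 : (1:ℝ) ≤ Fintype.card G := by exact_mod_cast Fintype.card_pos
  set n : ℝ := (Fintype.card G : ℝ) with hn
  have hn0 : 0 < n := by linarith
  obtain ⟨P, hP⟩ : ∃ P, P = p * n := ⟨_, rfl⟩
  rw [← hP] at hRP hP2
  have hlog0 := Real.log_nonneg hn1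
  have htR : R ≤ t := le_trans (le_mul_of_one_le_right (by linarith) (by linarith)) hlog
  have hlogt : Real.log n ≤ t := by
    have := mul_le_mul_of_nonneg_right (by linarith : 1 ≤ R) (by linarith : 0 ≤ 1 + Real.log n)
    linarith
  have hP0 : 0 < P := by rw [hP]; positivity
  have ht1 : 1 ≤ t := by linarith
  -- densities
  obtain ⟨q, hq⟩ : ∃ q, q = M * t / n := ⟨_, rfl⟩
  have hqn : q * n = M * t := by rw [hq]; field_simp
  have hq0 : 0 < q := by rw [hq]; positivity
  have hqp : q ≤ p / 12 := by
    have h : q * n ≤ p / 12 * n := by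
      have h1 := mul_le_mul_of_nonneg_right R5 ht.le
      have e : p / 12 * n = P / 12 := by rw [hP]; ring
      rw [hqn, e]; linarith
    exact le_of_mul_le_mul_right h hn0
  have hτp : τ * p ≤ 1 / 144 * p := mul_le_mul_of_nonneg_right hτ1 hp.le
  have hτp0 : 0 < τ * p := by positivity
  obtain ⟨D, hD⟩ : ∃ D, D = (1 - q) ^ 3 * (1 - τ * p) ^ 3 := ⟨_, rfl⟩
  have hD0 : 0 < D := by
    rw [hD]
    have a1 : 0 < 1 - q := by linarith
    have a2 : 0 < 1 - τ * p := by linarith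
    positivity
  have hDlow : 1 - p ≤ (1 - p / 2) * D := by
    have a1 := one_add_mul_le_pow (a := -q) (by linarith) 3
    have a2 := one_add_mul_le_pow (a := -(τ * p)) (by linarith) 3
    have a3 : (1 - 3 * q) * (1 - 3 * (τ * p)) ≤ D := by
      rw [hD]
      apply mul_le_mul
      · rw [sub_eq_add_neg 1 q]; push_cast at a1; linarith
      · rw [sub_eq_add_neg 1 (τ * p)]; push_cast at a2; linarith
      · linarith
      · apply pow_nonneg; linarith
    have a4 : 1 - 3 * q - 3 * (τ * p) ≤ D := by
      have := mul_nonneg hq0.le hτp0.le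
      linarith
    have a5 := mul_le_mul_of_nonneg_left a4 (by linarith : 0 ≤ 1 - p / 2)
    have a6 := mul_nonneg hp.le hq0.le
    have a7 := mul_nonneg hp.le hτp0.le
    linarith
  obtain ⟨pB, hpB⟩ : ∃ pB, pB = 1 - (1 - p) / D := ⟨_, rfl⟩
  have hpB1 : pB ≤ 1 := by
    have : 0 ≤ (1 - p) / D := div_nonneg (by linarith) hD0.le
    linarith
  have hpB2 : p / 2 ≤ pB := by
    have : (1 - p) / D ≤ 1 - p / 2 := by rw [div_le_iff₀ hD0]; exact hDlow
    linarith
  obtain ⟨b, hb⟩ : ∃ b, b = pB * n := ⟨_, rfl⟩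
  have hbP : P / 2 ≤ b := by
    have := mul_le_mul_of_nonneg_right hpB2 hn0.le
    rw [hb, hP]; linarith
  have hbt : R * t / 2 ≤ b := by linarith
  have hRt : t ≤ R * t / 8 := by
    have := mul_le_mul_of_nonneg_right R1 ht.le
    linarith
  have hfinal := main_all (G := G) (p0 := p) (pV := 1 - (1 - q) ^ 3) (q := q) (p := τ * p) (pB := pB)
    (L := L) (a := τ * P) (b := b) (v := M * t) (η := η) (η1 := η1) (κ := c0 * P) (e := s)
    (K := Real.exp (k * (3 * (L * (M * t))))) (s := s) (s2 := ε * b / 24) (ε := ε)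
    hτp0 (by linarith) (by linarith) hpB1 hq0 (by linarith)
    (by
      have : 1 - pB = (1 - p) / D := by rw [hpB]; ring
      rw [this]
      calc 1 - p = D * ((1 - p) / D) := (mul_div_cancel₀ _ hD0.ne').symm
        _ = (1 - q) ^ 3 * (1 - τ * p) ^ 3 * ((1 - p) / D) := by rw [← hD]
        _ = _ := by ring)
    (by ring) hL (by rw [hP]; ring) hb hqn.symm
    (by
      rw [← hn, ← htn]
      have : M ^ 2 ≤ t := R3.trans htR
      calc (M * t) ^ 2 = M ^ 2 * t ^ 2 := by ring
        _ ≤ t * t ^ 2 := by gcongr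
        _ = t ^ 3 := by ring)
    (by
      refine (exp_neg_le_inv (by positivity)).trans ?_
      refine one_div_le_one_div_of_le hL0 ?_
      have := le_mul_of_one_le_left ht.le hM1
      linarith)
    (by
      have e1 : q * (M * t) ^ 2 = M ^ 3 := by
        rw [hq, ← htn]; field_simp
      rw [e1]
      have := exp_neg_le_inv (x := M ^ 3 / (512 * L ^ 3)) (by positivity)
      calc _ ≤ L * (1 / (M ^ 3 / (512 * L ^ 3))) := by gcongr
        _ = L * (512 * L ^ 3) / M ^ 3 := by field_simp
        _ ≤ s := by rw [div_le_iff₀ (by positivity)]; linarith)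
    hη10
    (by
      rw [← hn]
      refine le_trans ?_ hP2
      have : τ * P ≤ P := mul_le_of_le_one_left hP0.le (by linarith)
      gcongr)
    (by
      rw [← hn, ← htn]
      have : t ≤ τ * P := by
        have := mul_le_mul_of_nonneg_left hRP hτ0.le
        have := mul_le_mul_of_nonneg_right R4 ht.le
        linarith
      gcongr)
    (by
      rw [hc0d]
      have : (1:ℝ) ≤ L ^ 3 := one_le_pow₀ hL
      rw [div_mul_eq_mul_div, div_le_div_iff₀ (by positivity) (by positivity)]
      have h1 : η1 ^ 2 * τ * P * (64 * L ^ 2) ≤ (η1 * 1) * τ * P * (64 * L ^ 2) := by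
        rw [sq]; gcongr
      have h2 : (η1 * 1) * τ * P * (64 * L ^ 2) * 1 ≤ (η1 * 1) * τ * P * (64 * L ^ 2) * (384 * L ^ 3) := by
        gcongr; linarith
      have e : η1 * (τ * P) * (24576 * L ^ 5) = (η1 * 1) * τ * P * (64 * L ^ 2) * (384 * L ^ 3) := by ring
      rw [e]; linarith)
    (by
      rw [hc0d]
      rw [div_mul_eq_mul_div, div_le_div_iff₀ (by positivity) (by positivity)]
      have h1 : η1 ^ 2 * τ * P * (12288 * L ^ 5) ≤ η1 ^ 2 * 1 * (2 * b) * (12288 * L ^ 5) := by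
        gcongr <;> linarith
      linarith)
    hs0 hs0.le hε.le N hN1 hN (Real.exp_pos _).le
    (by
      intro j hj
      rw [← hk]
      calc k ^ j ≤ (Real.exp k) ^ j := by gcongr; linarith [Real.add_one_le_exp k]
        _ = Real.exp (k * j) := by rw [← Real.exp_nat_mul]; ring_nf
        _ ≤ _ := by gcongr)
    (by rw [heta_d]; linarith) (by rw [hηd]; linarith) hη0
    (by
      have i1 : 3 * (L * (M * t)) ≤ ε * b / 24 := by
        have := mul_le_mul_of_nonneg_right R6 ht.le
        have := mul_le_mul_of_nonneg_left hbt hε.le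
        linarith
      have i2 : 3 * (L * (τ * P)) ≤ ε * b / 24 := by
        have e : 3 * (L * (τ * P)) = 3 * (L * τ) * P := by ring
        rw [e, hLτ]
        have := mul_le_mul_of_nonneg_left hbP hε.le
        linarith
      have hb0 : 0 < b := by linarith
      have hεb : 0 < ε * b := by positivity
      have i3 : L * s * b ≤ ε * b / 24 := by
        rw [hLs, hηd]; linarith
      have i4 : 2 * b * (4 * η + 4 * s + 2 * s) ≤ ε * b / 24 := by
        have := mul_le_mul_of_nonneg_left hsη hb0.le
        rw [hηd] at this ⊢
        linarith
      have i5 : 4 * s * (L * b) ≤ ε * b / 24 := by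
        have e : 4 * s * (L * b) = 4 * (L * s) * b := by ring
        rw [e, hLs, hηd]; linarith
      linarith)
  refine hfinal.trans ?_
  rw [← hk, ← hn]
  have hinv : Real.exp (-t) ≤ 1 / (4 * L) :=
    (exp_neg_le_inv ht).trans (one_div_le_one_div_of_le (by positivity) (by linarith))
  have e4 : 1 / (4 * L) = (1 / L) / 4 := by field_simp
  rw [e4] at hinv
  have hL' : 0 < 1 / L := by positivity
  have j1 : Real.exp (k * (3 * (L * (M * t)))) * (4 * Real.exp (-(c0 * P))) ≤ 1 / L := by
    have : Real.exp (k * (3 * (L * (M * t)))) * (4 * Real.exp (-(c0 * P)))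
        = 4 * Real.exp (k * (3 * (L * (M * t))) + -(c0 * P)) := by rw [Real.exp_add]; ring
    rw [this]
    have h2 : Real.exp (k * (3 * (L * (M * t))) + -(c0 * P)) ≤ Real.exp (-t) := by
      apply Real.exp_le_exp.2
      have := mul_le_mul_of_nonneg_right R7 ht.le
      have := mul_le_mul_of_nonneg_left hRP hc00.le
      linarith
    linarith
  have j2 : Real.exp (k * (3 * (L * (M * t)))) * (k * n * Real.exp (-(ε * b / 24 / 2))) ≤ 1 / L := by
    have hke : k ≤ Real.exp (k * t) := by
      have := Real.add_one_le_exp (k * t)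
      have := le_mul_of_one_le_right hk0 ht1
      linarith
    have hne : n = Real.exp (Real.log n) := (Real.exp_log hn0).symm
    have hne2 : n ≤ Real.exp t := by
      rw [hne]; exact Real.exp_le_exp.2 hlogt
    calc Real.exp (k * (3 * (L * (M * t)))) * (k * n * Real.exp (-(ε * b / 24 / 2)))
        ≤ Real.exp (k * (3 * (L * (M * t)))) * (Real.exp (k * t) * Real.exp t * Real.exp (-(ε * b / 24 / 2))) := by
          gcongr
      _ = Real.exp (k * (3 * (L * (M * t))) + (k * t + t + -(ε * b / 24 / 2))) := by
          rw [Real.exp_add, Real.exp_add, Real.exp_add]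
      _ ≤ Real.exp (-t) := by
          apply Real.exp_le_exp.2
          have := mul_le_mul_of_nonneg_right R8 ht.le
          have := mul_le_mul_of_nonneg_left hbt hε.le
          linarith
      _ ≤ 1 / L := by linarith
  have j3 : Real.exp (-(b / 4)) ≤ 1 / L := by
    have : Real.exp (-(b / 4)) ≤ Real.exp (-t) := Real.exp_le_exp.2 (by linarith)
    linarith
  have e7 : 7 / L = 7 * (1 / L) := by ring
  have hδL : 20 * (1 / L) = δ := by rw [hLdef]; field_simp
  rw [e7]
  linarith

lemma Good_mono {G : Type} [AddCommGroup G] {ε ε' : ℝ} (h : ε ≤ ε') {U : Finset G} (hU : Good ε U) :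
    Good ε' U := by
  intro H _ _ φ hφ
  obtain ⟨ψ, c, hc⟩ := hU H φ hφ
  exact ⟨ψ, c, hc.trans (mul_le_mul_of_nonneg_right h (by positivity))⟩

theorem freiman_hom_affine_almost_everywhere :
    ∃ η₀ : ℝ, 0 < η₀ ∧ ∀ η : ℝ, 0 < η → η ≤ η₀ →
      ∃ C : ℝ, 0 < C ∧ ∀ δ : ℝ, 0 < δ → ∃ n₀ : ℕ,
        ∀ (G : Type) [AddCommGroup G] [Fintype G], n₀ ≤ Fintype.card G →
          1 - δ ≤ randomSubsetProb G
              (C * (Fintype.card G : ℝ) ^ (-(2 : ℝ) / 3) *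
                Real.log (Fintype.card G) ^ ((1 : ℝ) / 3))
              (fun U => ∀ (H : Type) [AddCommGroup H] [AddGroup.FG H] (φ : G → H),
                FreimanHomOn U φ →
                  ∃ (ψ : G →+ H) (c : H),
                    ((U.filter fun x => ¬ φ x = ψ x + c).card : ℝ) ≤
                      80 * η * U.card) := by
  refine ⟨1, one_pos, fun η hη _ => ⟨1, one_pos, fun δ hδ => ?_⟩⟩
  obtain ⟨R, hR1, hR⟩ := main_const (ε := min (80 * η) 1) (δ := min δ 1)
    (lt_min (by positivity) one_pos) (min_le_right _ _) (lt_min hδ one_pos) (min_le_right _ _)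
  have ev1 : ∀ᶠ x : ℝ in Filter.atTop, Real.log x ≤ 1 / (2 * R) * x ^ ((1:ℝ) / 3) := by
    have := (isLittleO_log_rpow_atTop (r := (1:ℝ) / 3) (by norm_num)).bound
      (c := 1 / (2 * R)) (by positivity)
    filter_upwards [this, Filter.eventually_ge_atTop 1] with x hx hx1
    rw [Real.norm_of_nonneg (Real.log_nonneg hx1), Real.norm_of_nonneg (by positivity)] at hx
    exact hx
  have ev2 : ∀ᶠ x : ℝ in Filter.atTop, R ^ 3 ≤ Real.log x :=
    Real.tendsto_log_atTop.eventually_ge_atTop _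
  have ev3 : ∀ᶠ x : ℝ in Filter.atTop, 2 * R ≤ x ^ ((1:ℝ) / 3) :=
    (tendsto_rpow_atTop (by norm_num)).eventually_ge_atTop _
  have ev := ((ev1.and ev2).and ev3).and (Filter.eventually_ge_atTop 1)
  obtain ⟨n₀, hn₀⟩ := Filter.eventually_atTop.1 (tendsto_natCast_atTop_atTop.eventually ev)
  refine ⟨n₀, ?_⟩
  intro G _ _ hG
  obtain ⟨⟨⟨h1, h2⟩, h3⟩, h4⟩ := hn₀ _ hG
  set n : ℝ := (Fintype.card G : ℝ) with hn
  have hn0 : 0 < n := by linarith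
  obtain ⟨t, ht⟩ : ∃ t, t = n ^ ((1:ℝ) / 3) := ⟨_, rfl⟩
  obtain ⟨l, hl⟩ : ∃ l, l = Real.log n ^ ((1:ℝ) / 3) := ⟨_, rfl⟩
  have hlog0 : 0 < Real.log n := lt_of_lt_of_le (by positivity) h2
  have ht0 : 0 < t := by rw [ht]; positivity
  have hl0 : 0 < l := by rw [hl]; positivity
  have ht3 : t ^ 3 = n := by
    rw [ht, ← Real.rpow_natCast, ← Real.rpow_mul hn0.le]; norm_num
  have hl3 : l ^ 3 = Real.log n := by
    rw [hl, ← Real.rpow_natCast, ← Real.rpow_mul hlog0.le]; norm_num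
  rw [← ht] at h1 h3
  obtain ⟨p, hp⟩ : ∃ p, p = 1 * n ^ (-(2 : ℝ) / 3) * Real.log n ^ ((1 : ℝ) / 3) := ⟨_, rfl⟩
  have hp0 : 0 < p := by rw [hp]; positivity
  have hpn : p * n = t * l := by
    rw [hp, one_mul, ← hl, mul_right_comm, ht]
    congr 1
    nth_rewrite 2 [← Real.rpow_one n]
    rw [← Real.rpow_add hn0]; norm_num
  have hlR : R ≤ l := by
    rw [← hl3] at h2
    exact le_of_pow_le_pow_left₀ (by norm_num) hl0.le h2
  have hlt : l ^ 3 ≤ t := by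
    rw [hl3]
    refine h1.trans ?_
    have : 1 / (2 * R) ≤ 1 := by rw [div_le_one (by positivity)]; linarith
    nlinarith
  have hl1 : 1 ≤ l := hR1.trans hlR
  have hl2t : l ^ 2 ≤ t := (pow_le_pow_right₀ hl1 (by norm_num)).trans hlt
  have hlt1 : l ≤ t := (le_self_pow₀ hl1 (by norm_num)).trans hlt
  have ht1 : 1 ≤ t := hl1.trans hlt1
  have hp1 : p ≤ 1 := by
    have : p * n ≤ 1 * n := by
      rw [hpn, ← ht3]
      have : t ^ 2 ≤ t ^ 3 := pow_le_pow_right₀ ht1 (by norm_num)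
      nlinarith
    exact le_of_mul_le_mul_right this hn0
  have hmain := hR G t p ht0 ht3 hp0 hp1
    (by rw [← hn, hpn]; nlinarith)
    (by
      rw [← hn, hpn, ← ht3]
      calc (t * l) ^ 2 = t ^ 2 * l ^ 2 := by ring
        _ ≤ t ^ 2 * t := by gcongr
        _ = t ^ 3 := by ring)
    (by
      rw [← hn]
      have : R * Real.log n ≤ t / 2 := by
        have := mul_le_mul_of_nonneg_left h1 (by linarith : 0 ≤ R)
        refine this.trans (le_of_eq ?_)
        field_simp
      linarith)
  rw [prob_eq, ← hp]
  have hfin : Ex (G := G) p (fun U => ind (¬ (∀ (H : Type) [AddCommGroup H] [AddGroup.FG H] (φ : G → H),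
                FreimanHomOn U φ →
                  ∃ (ψ : G →+ H) (c : H),
                    ((U.filter fun x => ¬ φ x = ψ x + c).card : ℝ) ≤
                      80 * η * U.card))) ≤ δ := by
    refine le_trans (Ex_mono hp0.le hp1 fun U => ind_mono ?_) (hmain.trans (min_le_left _ _))
    intro h h'
    exact h (Good_mono (min_le_left _ _) h')
  linarith

end
end

section
/- Let G be a finite Abelian group and let η > 0. Then every (1 − η)-additively connected subset U of G has the (1 − η)-extension property. That is, if no subset W of U with |W| ≤ η|U| satisfies ((U∖W) + (U∖W) − (U∖W)) ∩ W = ∅, then every Freiman homomorphism φ from U to an Abelian group H that coincides on a subset V_0 ⊆ U with |V_0| ≥ (1 − η)|U| with the restriction to V_0 of an affine homomorphism ψ : G → H satisfies φ(u) = ψ(u) for every u ∈ U. -/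
open scoped Classical
open Finset

noncomputable section

/-- `U` is `(1 - η)`-additively connected: no nonempty subset `W ⊆ U` with
`|W| ≤ η |U|` is additively isolated in `U`, i.e. for every such `W`, writing
`V = U \ W`, the set `V + V - V` meets `W`. -/
def AddConnected {G : Type*} [AddCommGroup G] (η : ℝ) (U : Finset G) : Prop :=
  ∀ W ⊆ U, W.Nonempty → (W.card : ℝ) ≤ η * U.card →
    ∃ v₁ ∈ U \ W, ∃ v₂ ∈ U \ W, ∃ v₃ ∈ U \ W, v₁ + v₂ - v₃ ∈ W

theorem extension_property_of_additively_connected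
    {G : Type*} [AddCommGroup G] [Fintype G] (η : ℝ) (hη : 0 < η)
    (U : Finset G) (hU : AddConnected η U)
    (H : Type*) [AddCommGroup H] (φ : G → H) (hφ : FreimanHomOn U φ)
    (V₀ : Finset G) (hV₀U : V₀ ⊆ U) (hV₀card : (1 - η) * U.card ≤ V₀.card)
    (ψ : G →+ H) (h : H) (hagree : ∀ v ∈ V₀, φ v = ψ v + h) :
    ∀ u ∈ U, φ u = ψ u + h := by
  intro u hu
  by_contra hne
  have hWU : U.filter (fun x => ¬ φ x = ψ x + h) ⊆ U := Finset.filter_subset _ _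
  have hcard : (((U.filter (fun x => ¬ φ x = ψ x + h)).card : ℕ) : ℝ) ≤ η * U.card := by
    have h1 : U.filter (fun x => ¬ φ x = ψ x + h) ⊆ U \ V₀ := by
      intro x hx
      rw [Finset.mem_filter] at hx
      exact Finset.mem_sdiff.2 ⟨hx.1, fun hv => hx.2 (hagree x hv)⟩
    have h2 := Finset.card_le_card h1
    have h3 := Finset.card_sdiff_add_card_eq_card hV₀U
    have h4 : (((U.filter (fun x => ¬ φ x = ψ x + h)).card : ℕ) : ℝ) + V₀.card ≤ U.card := by
      exact_mod_cast (by omega)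
    linarith
  obtain ⟨a, ha, b, hb, c, hc, hw⟩ :=
    hU _ hWU ⟨u, Finset.mem_filter.2 ⟨hu, hne⟩⟩ hcard
  have key : ∀ x ∈ U \ U.filter (fun x => ¬ φ x = ψ x + h), x ∈ U ∧ φ x = ψ x + h := by
    intro x hx
    rw [Finset.mem_sdiff, Finset.mem_filter] at hx
    exact ⟨hx.1, by_contra fun hn => hx.2 ⟨hx.1, hn⟩⟩
  obtain ⟨ha, ha'⟩ := key a ha
  obtain ⟨hb, hb'⟩ := key b hb
  obtain ⟨hc, hc'⟩ := key c hc
  rw [Finset.mem_filter] at hw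
  obtain ⟨hw, hw'⟩ := hw
  apply hw'
  have e := hφ a ha b hb _ hw c hc (by abel)
  rw [ha', hb', hc'] at e
  rw [eq_sub_of_add_eq e.symm, map_sub, map_add]
  abel

end
end

section
/- There exists an absolute constant C > 0 such that for all sufficiently large n the following holds: for every finite Abelian group G of order n, if U is a uniformly random subset of G of size ⌈C (n log n)^{1/3}⌉, then the probability that U is (1 − 10^{-5})-additively connected is at least 1 − 1/n. -/
open scoped Classical
open Finset
noncomputable section

/-- The probability that a uniformly random subset of `G` of size `m`
satisfies the event `E`. -/
def uniformSubsetProb (G : Type*) [Fintype G] (m : ℕ) (E : Finset G → Prop) : ℝ :=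
  (((Finset.univ : Finset G).powersetCard m).filter E).card /
    ((Finset.univ : Finset G).powersetCard m).card

def shifts {G : Type} [AddCommGroup G] (X : Finset G) {t : ℕ} (y : Fin t → G) : Finset G :=
  Finset.univ.biUnion (fun i => X.image (fun x => x + y i))

lemma mem_shifts {G : Type} [AddCommGroup G] (X : Finset G) {t : ℕ} (y : Fin t → G) (g : G) :
    g ∈ shifts X y ↔ ∃ i, ∃ x ∈ X, x + y i = g := by
  simp only [shifts, mem_biUnion, mem_image, mem_univ, true_and]

lemma sum_new {G : Type} [AddCommGroup G] [Fintype G] (X Y : Finset G) :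
    ∑ y : G, (((X.image (fun x => x + y)) \ Y).card : ℝ) = X.card * (Fintype.card G - Y.card) := by
  have h1 : ∀ y : G, (((X.image (fun x => x + y)) \ Y).card : ℝ)
      = ∑ x ∈ X, if x + y ∈ Y then (0:ℝ) else 1 := by
    intro y
    have : (X.image (fun x => x + y)) \ Y = (X.filter (fun x => ¬ (x + y ∈ Y))).image (fun x => x + y) := by
      ext g; simp only [mem_sdiff, mem_image, mem_filter]; grind
    rw [this, card_image_of_injective _ (add_left_injective y), card_filter]
    push_cast
    apply sum_congr rfl; intros; split_ifs <;> simp_all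
  simp_rw [h1]
  rw [sum_comm]
  have h2 : ∀ x ∈ X, ∑ y : G, (if x + y ∈ Y then (0:ℝ) else 1) = Fintype.card G - Y.card := by
    intro x _
    rw [Fintype.sum_equiv (Equiv.addLeft x) _ (fun g => if g ∈ Y then (0:ℝ) else 1) (by intro y; rfl)]
    have : ∀ g : G, (if g ∈ Y then (0:ℝ) else 1) = 1 - (if g ∈ Y then (1:ℝ) else 0) := by
      intro g; split_ifs <;> simp
    simp_rw [this]
    simp
  rw [sum_congr rfl h2, sum_const, nsmul_eq_mul]

lemma exp_neg_le_lin (u : ℝ) (h0 : 0 ≤ u) (h1 : u ≤ 1) : Real.exp (-u) ≤ 1 - u / 2 := by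
  have := convexOn_exp.2 (Set.mem_univ (0:ℝ)) (Set.mem_univ (-1:ℝ)) (sub_nonneg.2 h1) h0 (by ring)
  have h2 : Real.exp (-1) ≤ 1/2 := by
    have := Real.exp_neg_one_lt_d9; linarith
  simp at this
  nlinarith

lemma card_filter_cons {G : Type} [Fintype G] (t : ℕ) (P : (Fin (t+1) → G) → Prop) :
    ((univ.filter P).card : ℝ) = ∑ g : G, ((univ.filter (fun y : Fin t → G => P (Fin.cons g y))).card : ℝ) := by
  simp_rw [card_filter]
  push_cast
  rw [← Fintype.sum_equiv (Fin.consEquiv (fun _ : Fin (t+1) => G)) (fun p => if P (Fin.cons p.1 p.2) then (1:ℝ) else 0) _ (by intro x; rfl), Fintype.sum_prod_type]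

lemma growth {G : Type} [AddCommGroup G] [Fintype G] (X : Finset G) (hX : X.Nonempty) (M : ℝ)
    (hM : M ≤ Fintype.card G / 4) (t : ℕ) : ∀ Y : Finset G,
    ((univ.filter (fun y : Fin t → G => ((Y ∪ shifts X y).card : ℝ) < M)).card : ℝ) ≤
      (Fintype.card G : ℝ) ^ t * Real.exp (-(3/8) * t + (M - Y.card) / X.card) := by
  have hs : (0:ℝ) < X.card := by exact_mod_cast hX.card_pos
  have hn : (0:ℝ) < Fintype.card G := by
    obtain ⟨x, _⟩ := hX
    exact_mod_cast Fintype.card_pos_iff.2 ⟨x⟩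
  induction t with
  | zero =>
    intro Y
    by_cases h : (Y.card : ℝ) < M
    · have : (1:ℝ) ≤ Real.exp ((M - Y.card) / X.card) := by
        apply Real.one_le_exp; apply div_nonneg <;> linarith
      have h2 : ((univ.filter (fun y : Fin 0 → G => ((Y ∪ shifts X y).card : ℝ) < M)).card : ℝ) ≤ 1 := by
        have := card_le_univ (univ.filter (fun y : Fin 0 → G => ((Y ∪ shifts X y).card : ℝ) < M))
        simp only [Fintype.card_unique] at this
        exact_mod_cast this
      rw [pow_zero, one_mul, Nat.cast_zero, mul_zero, zero_add]; exact h2.trans this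
    · simp [shifts, h]; positivity
  | succ t ih =>
    intro Y
    by_cases h : (Y.card : ℝ) < M
    swap
    · rw [filter_false_of_mem]
      · simp; positivity
      · intro y _ hh
        apply h
        refine lt_of_le_of_lt ?_ hh
        exact_mod_cast card_le_card subset_union_left
    rw [card_filter_cons]
    have key : ∀ g : G, ((univ.filter (fun y : Fin t → G => ((Y ∪ shifts X (Fin.cons g y : Fin (t+1) → G)).card : ℝ) < M)).card : ℝ)
        ≤ (Fintype.card G : ℝ) ^ t * Real.exp (-(3/8) * t + (M - Y.card) / X.card) *
          (1 - (((X.image (fun x => x + g)) \ Y).card : ℝ) / X.card / 2) := by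
      intro g
      have e : ∀ y : Fin t → G, Y ∪ shifts X (Fin.cons g y : Fin (t+1) → G) = (Y ∪ X.image (fun x => x + g)) ∪ shifts X y := by
        intro y; ext a
        simp only [mem_union, mem_shifts, Fin.exists_fin_succ, mem_image, Fin.cons_zero, Fin.cons_succ]
        rw [or_assoc]
      simp_rw [e]
      refine (ih _).trans ?_
      have hc : ((Y ∪ X.image (fun x => x + g)).card : ℝ) = Y.card + ((X.image (fun x => x + g)) \ Y).card := by
        rw [← union_sdiff_self_eq_union, card_union_of_disjoint disjoint_sdiff]; push_cast; rfl
      have hle : (((X.image (fun x => x + g)) \ Y).card : ℝ) ≤ X.card := by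
        exact_mod_cast (card_le_card sdiff_subset).trans card_image_le
      rw [hc, show -(3/8) * (t:ℝ) + (M - (Y.card + ((X.image (fun x => x + g)) \ Y).card)) / X.card
        = (-(3/8) * (t:ℝ) + (M - Y.card)/ X.card) + -(((X.image (fun x => x + g)) \ Y).card / X.card : ℝ) by ring,
        Real.exp_add _ (-_), ← mul_assoc]
      gcongr
      apply exp_neg_le_lin
      · positivity
      · rw [div_le_one hs]; exact hle
    refine (sum_le_sum (fun g _ => key g)).trans ?_
    rw [← mul_sum, sum_sub_distrib, ← sum_div, ← sum_div, sum_new]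
    have e2 : (∑ g : G, (1:ℝ)) - (X.card : ℝ) * (Fintype.card G - Y.card) / X.card / 2 ≤ Fintype.card G * Real.exp (-(3/8)) := by
      rw [mul_div_cancel_left₀ _ hs.ne']
      have := Real.add_one_le_exp (-(3/8):ℝ)
      simp
      nlinarith
    calc _ ≤ (Fintype.card G : ℝ) ^ t * Real.exp (-(3/8) * t + (M - Y.card) / X.card) * (Fintype.card G * Real.exp (-(3/8))) := by gcongr
      _ = (Fintype.card G : ℝ) ^ (t+1) * (Real.exp (-(3/8) * t + (M - Y.card) / X.card) * Real.exp (-(3/8))) := by ring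
      _ = _ := by rw [← Real.exp_add]; push_cast; ring_nf

lemma growth' {G : Type} [AddCommGroup G] [Fintype G] (X : Finset G) (hX : X.Nonempty) (M : ℝ) (t : ℕ)
    (hM : M ≤ Fintype.card G / 4) (hM2 : M ≤ X.card * t / 16) :
    ((univ.filter (fun y : Fin t → G => ((shifts X y).card : ℝ) < M)).card : ℝ) ≤
      (Fintype.card G : ℝ) ^ t * Real.exp (-(1/4) * t) := by
  have := growth X hX M hM t ∅
  simp only [empty_union, card_empty] at this
  refine this.trans ?_
  have hs : (0:ℝ) < X.card := by exact_mod_cast hX.card_pos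
  gcongr
  have : (M - (0:ℕ)) / X.card ≤ t / 16 := by
    rw [div_le_iff₀ hs]; push_cast; linarith
  have ht : (0:ℝ) ≤ t := by positivity
  linarith

lemma avoid {G : Type} [AddCommGroup G] [Fintype G] [Nonempty G] (S : Finset G) (t : ℕ) :
    ((univ.filter (fun y : Fin t → G => ∀ l, y l ∉ S)).card : ℝ) ≤
      (Fintype.card G : ℝ) ^ t * Real.exp (-(S.card / Fintype.card G) * t) := by
  have hn : (0:ℝ) < Fintype.card G := by exact_mod_cast Fintype.card_pos
  have : univ.filter (fun y : Fin t → G => ∀ l, y l ∉ S) = Fintype.piFinset (fun _ => Sᶜ) := by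
    ext; simp
  rw [this, Fintype.card_piFinset]
  simp only [prod_const, card_univ, Fintype.card_fin]
  rw [mul_comm _ (t:ℝ), Real.exp_nat_mul, ← mul_pow]
  push_cast
  gcongr
  rw [card_compl, Nat.cast_sub (card_le_univ S)]
  have := Real.add_one_le_exp (-(S.card / Fintype.card G):ℝ)
  calc _ = (Fintype.card G : ℝ) * (-(S.card / Fintype.card G)+1) := by field_simp; ring
    _ ≤ _ := by gcongr

/-- the three-block estimate -/
lemma three {G : Type} [AddCommGroup G] [Fintype G] (X : Finset G) (hX : X.Nonempty) (t : ℕ) (ht : 16 ≤ t) :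
    ((univ.filter (fun p : (Fin t → G) × (Fin t → G) × (Fin t → G) =>
      ∀ l, p.2.2 l ∉ shifts (shifts X p.1) p.2.1)).card : ℝ) ≤
      (Fintype.card G : ℝ) ^ (3 * t) *
        (3 * Real.exp (-(1/4) * t) + Real.exp (-(t ^ 3 / (256 * Fintype.card G))) ^ X.card) := by
  have hne : Nonempty G := ⟨hX.choose⟩
  set n : ℝ := ((Fintype.card G : ℕ) : ℝ) with hn
  have hn0 : (0:ℝ) < n := by rw [hn]; exact_mod_cast Fintype.card_pos
  set k : ℝ := ((X.card : ℕ) : ℝ) with hk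
  have hk0 : (0:ℝ) < k := by rw [hk]; exact_mod_cast hX.card_pos
  have htR : (16:ℝ) ≤ t := by exact_mod_cast ht
  set M1 : ℝ := min (n/4) (k * t / 16) with hM1
  set M2 : ℝ := min (n/4) (M1 * t / 16) with hM2
  have hM1p : 0 < M1 := by rw [hM1]; apply lt_min <;> positivity
  have hM2' : min (n/4) (k * t^2/256) ≤ M2 := by
    rw [hM2]; apply le_min (min_le_left _ _)
    rw [hM1, mul_div_assoc (min _ _) (t:ℝ) 16, min_mul_of_nonneg _ _ (by positivity)]
    apply le_min
    · refine (min_le_left _ _).trans ?_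
      have : 1 ≤ (t:ℝ)/16 := by linarith
      nlinarith
    · refine (min_le_right _ _).trans (le_of_eq ?_); ring
  have hexp : Real.exp (-(M2 / n) * t) ≤ Real.exp (-(1/4) * t) + Real.exp (-(t ^ 3 / (256 * n))) ^ X.card := by
    rw [← Real.exp_nat_mul, ← hk]
    rcases min_le_iff.1 hM2' with h | h
    · have : (1/4:ℝ) ≤ M2 / n := by rw [le_div_iff₀ hn0]; linarith
      have : Real.exp (-(M2 / n) * t) ≤ Real.exp (-(1/4) * t) := by gcongr
      have := Real.exp_pos (k * -(t ^ 3 / (256 * n)))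
      linarith
    · have : Real.exp (-(M2 / n) * t) ≤ Real.exp (k * -(t ^ 3 / (256 * n))) := by
        apply Real.exp_le_exp.2
        calc -(M2/n) * (t:ℝ) ≤ -((k * t^2/256)/n) * t := by gcongr
          _ = _ := by field_simp
      have := Real.exp_pos (-(1/4) * (t:ℝ))
      linarith
  set e1 := Real.exp (-(1/4) * (t:ℝ)) with he1
  set e2 := Real.exp (-(t ^ 3 / (256 * n))) ^ X.card with he2
  have he1p : 0 < e1 := Real.exp_pos _
  have he2p : 0 < e2 := by positivity
  -- inner-most
  have inner : ∀ T : Finset G, M1 ≤ T.card → 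
      ((univ.filter (fun q : (Fin t → G) × (Fin t → G) => ∀ l, q.2 l ∉ shifts T q.1)).card : ℝ)
        ≤ n ^ (2*t) * (2 * e1 + e2) := by
    intro T hT
    have hTne : T.Nonempty := by
      rw [← card_pos]; exact_mod_cast hM1p.trans_le hT
    have g := growth' T hTne M2 t (min_le_left _ _) ((min_le_right _ _).trans (by gcongr))
    rw [← hn] at g
    have : ((univ.filter (fun q : (Fin t → G) × (Fin t → G) => ∀ l, q.2 l ∉ shifts T q.1)).card : ℝ)
      = ∑ d : Fin t → G, ((univ.filter (fun b : Fin t → G => ∀ l, b l ∉ shifts T d)).card : ℝ) := by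
      simp_rw [card_filter]; push_cast; rw [Fintype.sum_prod_type]
    rw [this]
    have step : ∀ d : Fin t → G, ((univ.filter (fun b : Fin t → G => ∀ l, b l ∉ shifts T d)).card : ℝ)
        ≤ n^t * (if ((shifts T d).card : ℝ) < M2 then 1 else 0) + n^t * (e1 + e2) := by
      intro d
      split_ifs with h
      · have : ((univ.filter (fun b : Fin t → G => ∀ l, b l ∉ shifts T d)).card : ℝ) ≤ n^t := by
          have := card_le_univ (univ.filter (fun b : Fin t → G => ∀ l, b l ∉ shifts T d))
          rw [Fintype.card_fun, Fintype.card_fin] at this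
          rw [hn]; exact_mod_cast this
        have : 0 ≤ n^t * (e1+e2) := by positivity
        linarith
      · have := avoid (shifts T d) t
        rw [← hn] at this
        refine this.trans ?_
        rw [mul_zero, zero_add]
        gcongr
        refine le_trans ?_ hexp
        gcongr
        exact not_lt.1 h
    refine (sum_le_sum (fun d _ => step d)).trans ?_
    rw [sum_add_distrib, ← mul_sum, ← Nat.cast_one, ← Nat.cast_zero]
    rw [card_filter] at g
    push_cast at g ⊢
    simp only [sum_const, card_univ, Fintype.card_fun, Fintype.card_fin, nsmul_eq_mul]
    push_cast
    rw [← hn]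
    calc _ ≤ n^t * (n^t * e1) + n^t * (n^t * (e1+e2)) := by gcongr
      _ = _ := by ring
  have g := growth' X hX M1 t (min_le_left _ _) (min_le_right _ _)
  rw [← hn] at g
  have : ((univ.filter (fun p : (Fin t → G) × (Fin t → G) × (Fin t → G) =>
      ∀ l, p.2.2 l ∉ shifts (shifts X p.1) p.2.1)).card : ℝ)
      = ∑ a : Fin t → G, ((univ.filter (fun q : (Fin t → G) × (Fin t → G) => ∀ l, q.2 l ∉ shifts (shifts X a) q.1)).card : ℝ) := by
    simp_rw [card_filter]; push_cast; rw [Fintype.sum_prod_type]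
  rw [this]
  have step : ∀ a : Fin t → G, ((univ.filter (fun q : (Fin t → G) × (Fin t → G) => ∀ l, q.2 l ∉ shifts (shifts X a) q.1)).card : ℝ)
      ≤ n^(2*t) * (if ((shifts X a).card : ℝ) < M1 then 1 else 0) + n^(2*t) * (2 * e1 + e2) := by
    intro a
    split_ifs with h
    · have : ((univ.filter (fun q : (Fin t → G) × (Fin t → G) => ∀ l, q.2 l ∉ shifts (shifts X a) q.1)).card : ℝ) ≤ n^(2*t) := by
        have := card_le_univ (univ.filter (fun q : (Fin t → G) × (Fin t → G) => ∀ l, q.2 l ∉ shifts (shifts X a) q.1))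
        rw [Fintype.card_prod, Fintype.card_fun, Fintype.card_fin, ← pow_add, ← two_mul] at this
        rw [hn]; exact_mod_cast this
      have : 0 ≤ n^(2*t) * (2 * e1+e2) := by positivity
      linarith
    · rw [mul_zero, zero_add]
      exact inner _ (not_lt.1 h)
  refine (sum_le_sum (fun d _ => step d)).trans ?_
  rw [sum_add_distrib, ← mul_sum]
  rw [card_filter] at g
  push_cast at g
  simp only [sum_const, card_univ, Fintype.card_fun, Fintype.card_fin, nsmul_eq_mul]
  push_cast
  rw [← hn]
  calc _ ≤ n^(2*t) * (n^t * e1) + n^t * (n^(2*t) * (2*e1+e2)) := by gcongr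
    _ = _ := by ring

lemma perI {G : Type} [AddCommGroup G] [Fintype G] (m t : ℕ) (ht : 16 ≤ t) (I : Finset (Fin m))
    (hI : I.Nonempty) (hIm : 3 * t + I.card ≤ m) :
    ((univ.filter (fun x : Fin m → G => Function.Injective x ∧
      ∀ j₁ ∉ I, ∀ j₂ ∉ I, ∀ j₃ ∉ I, ∀ i ∈ I, x j₁ + x j₂ - x j₃ ≠ x i)).card : ℝ) ≤
      (Fintype.card G : ℝ) ^ m *
        (3 * Real.exp (-(1/4) * t) + Real.exp (-(t ^ 3 / (256 * Fintype.card G))) ^ I.card) := by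
  obtain ⟨e⟩ : Nonempty (Fin t ⊕ Fin t ⊕ Fin t ↪ {j // j ∉ I}) := by
    apply Function.Embedding.nonempty_of_card_le
    simp only [Fintype.card_sum, Fintype.card_fin, Fintype.card_subtype_compl, Fintype.card_coe]
    omega
  set e' : Fin t ⊕ Fin t ⊕ Fin t → Fin m := fun s => (e s : Fin m) with he'
  have he'i : Function.Injective e' := Subtype.val_injective.comp e.injective
  have he'I : ∀ s, e' s ∉ I := fun s => (e s).2
  set B := univ.filter (fun x : Fin m → G => Function.Injective x ∧
      ∀ j₁ ∉ I, ∀ j₂ ∉ I, ∀ j₃ ∉ I, ∀ i ∈ I, x j₁ + x j₂ - x j₃ ≠ x i) with hB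
  let R : (Fin m → G) → ({j // j ∉ Set.range e'} → G) := fun x j => x j
  have h1 : B.card = ∑ z : {j // j ∉ Set.range e'} → G, (B.filter (fun x => R x = z)).card :=
    card_eq_sum_card_fiberwise (fun _ _ => by simp)
  have h2 : ∀ z : {j // j ∉ Set.range e'} → G, ((B.filter (fun x => R x = z)).card : ℝ) ≤
      (Fintype.card G : ℝ) ^ (3 * t) *
        (3 * Real.exp (-(1/4) * t) + Real.exp (-(t ^ 3 / (256 * Fintype.card G))) ^ I.card) := by
    intro z
    by_cases hne : (B.filter (fun x => R x = z)).Nonempty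
    swap
    · rw [not_nonempty_iff_eq_empty.1 hne]; simp; positivity
    obtain ⟨x0, hx0⟩ := hne
    simp only [hB, mem_filter, mem_univ, true_and] at hx0
    obtain ⟨⟨hinj, -⟩, hz⟩ := hx0
    have hcard : (I.image (fun i => - x0 i)).card = I.card :=
      card_image_of_injective _ (neg_injective.comp hinj)
    rw [← hcard]
    refine le_trans ?_ (three (I.image (fun i => - x0 i)) (hI.image _) t ht)
    norm_cast
    apply card_le_card_of_injOn (fun x => ((fun i => x (e' (Sum.inl i))),
      (fun i => x (e' (Sum.inr (Sum.inl i)))), (fun i => x (e' (Sum.inr (Sum.inr i))))))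
    · intro x hx
      simp only [hB, coe_filter, mem_filter, mem_univ, true_and, Set.mem_ofPred_eq] at hx ⊢
      obtain ⟨⟨-, hx⟩, hxz⟩ := hx
      intro l hl
      simp only [mem_shifts, mem_image] at hl
      obtain ⟨j, y, ⟨i, w, ⟨a, ha, rfl⟩, rfl⟩, h⟩ := hl
      apply hx _ (he'I (Sum.inl i)) _ (he'I (Sum.inr (Sum.inl j))) _ (he'I (Sum.inr (Sum.inr l))) a ha
      have : x a = x0 a := by
        have ha' : a ∉ Set.range e' := by
          rintro ⟨s, rfl⟩; exact he'I s ha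
        exact congrFun (hxz.trans hz.symm) ⟨a, ha'⟩
      rw [← h, this]; abel
    · intro x hx x' hx' h
      simp only [coe_filter, mem_filter, Set.mem_ofPred_eq] at hx hx'
      simp only [Prod.mk.injEq] at h
      funext j
      by_cases hj : j ∈ Set.range e'
      · obtain ⟨s, rfl⟩ := hj
        rcases s with s | s | s
        · exact congrFun h.1 s
        · exact congrFun h.2.1 s
        · exact congrFun h.2.2 s
      · exact congrFun (hx.2.trans hx'.2.symm) ⟨j, hj⟩
  rw [h1]
  push_cast
  refine (sum_le_sum (fun z _ => h2 z)).trans (le_of_eq ?_)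
  have hc : Fintype.card {j // j ∉ Set.range e'} = m - 3 * t := by
    have h3 : Fintype.card {j // j ∈ Set.range e'} = 3 * t := by
      rw [← Fintype.card_congr (Equiv.ofInjective e' he'i)]
      simp only [Fintype.card_sum, Fintype.card_fin]; ring
    rw [Fintype.card_subtype_compl, h3, Fintype.card_fin]
  rw [sum_const, card_univ, nsmul_eq_mul, Fintype.card_fun, hc]
  push_cast
  rw [← mul_assoc, ← pow_add]
  congr 2
  omega

lemma sum_pow_univ (m : ℕ) (z : ℝ) : ∑ I : Finset (Fin m), z ^ I.card = (1 + z) ^ m := by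
  have := Finset.sum_pow_mul_eq_add_pow z 1 (univ : Finset (Fin m))
  simp at this
  rw [this, add_comm]

/-- count of bad injective sequences -/
lemma bad_seq {G : Type} [AddCommGroup G] [Fintype G] (m t : ℕ) (ht : 16 ≤ t)
    (hm : 3 * (t:ℝ) + 1 / 100000 * m ≤ m) :
    ((univ.filter (fun x : Fin m → G => Function.Injective x ∧
      ¬ AddConnected (1 / 100000) (univ.image x))).card : ℝ) ≤
      (Fintype.card G : ℝ) ^ m *
        (3 * Real.exp (-(1/4) * t) * Real.exp (2 / 100 * m) +
          ((1 + Real.exp (-(t ^ 3 / (256 * Fintype.card G)))) ^ m - 1)) := by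
  set z := Real.exp (-((t:ℝ) ^ 3 / (256 * Fintype.card G))) with hz
  have hz0 : 0 < z := Real.exp_pos _
  set F : Finset (Fin m) → Finset (Fin m → G) := fun I => univ.filter (fun x : Fin m → G => Function.Injective x ∧
      ∀ j₁ ∉ I, ∀ j₂ ∉ I, ∀ j₃ ∉ I, ∀ i ∈ I, x j₁ + x j₂ - x j₃ ≠ x i) with hF
  set S : Finset (Finset (Fin m)) := univ.filter (fun I => I.Nonempty ∧ (I.card : ℝ) ≤ 1 / 100000 * m) with hS
  have hsub : (univ.filter (fun x : Fin m → G => Function.Injective x ∧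
      ¬ AddConnected (1 / 100000) (univ.image x))) ⊆ S.biUnion F := by
    intro x hx
    simp only [mem_filter, mem_univ, true_and] at hx
    obtain ⟨hinj, hx⟩ := hx
    unfold AddConnected at hx
    push Not at hx
    obtain ⟨W, hW, hWne, hWc, hx⟩ := hx
    rw [card_image_of_injective _ hinj, card_univ, Fintype.card_fin] at hWc
    have hWim : (univ.filter (fun j => x j ∈ W)).image x = W := by
      ext g; simp only [mem_image, mem_filter, mem_univ, true_and]
      constructor
      · rintro ⟨j, hj, rfl⟩; exact hj
      · intro hg
        obtain ⟨j, -, rfl⟩ := mem_image.1 (hW hg)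
        exact ⟨j, hg, rfl⟩
    have hc : (univ.filter (fun j => x j ∈ W)).card = W.card := by
      conv_rhs => rw [← hWim, card_image_of_injective _ hinj]
    simp only [mem_biUnion, hS, hF, mem_filter, mem_univ, true_and]
    refine ⟨univ.filter (fun j => x j ∈ W), ⟨?_, ?_⟩, hinj, ?_⟩
    · rw [← card_pos, hc]; exact hWne.card_pos
    · rw [hc]; exact hWc
    · intro j₁ h1 j₂ h2 j₃ h3 i hi h
      simp only [mem_filter, mem_univ, true_and] at h1 h2 h3 hi
      have hm : ∀ j, x j ∉ W → x j ∈ univ.image x \ W := fun j hj => by simp [hj]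
      exact hx _ (hm _ h1) _ (hm _ h2) _ (hm _ h3) (h ▸ hi)
  have h1 : ((univ.filter (fun x : Fin m → G => Function.Injective x ∧
      ¬ AddConnected (1 / 100000) (univ.image x))).card : ℝ) ≤ ∑ I ∈ S, ((F I).card : ℝ) := by
    exact_mod_cast (card_le_card hsub).trans card_biUnion_le
  refine h1.trans ?_
  have h2 : ∀ I ∈ S, ((F I).card : ℝ) ≤ (Fintype.card G : ℝ) ^ m * (3 * Real.exp (-(1/4) * t) + z ^ I.card) := by
    intro I hI
    simp only [hS, mem_filter, mem_univ, true_and] at hI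
    apply perI m t ht I hI.1
    have : (3:ℝ) * t + I.card ≤ m := by linarith
    exact_mod_cast this
  refine (sum_le_sum h2).trans ?_
  rw [← mul_sum, sum_add_distrib, sum_const, nsmul_eq_mul, mul_comm (S.card : ℝ)]
  gcongr
  · -- entropy
    have : (S.card : ℝ) = ∑ I ∈ S, (1:ℝ) := by simp
    rw [this]
    have he5 : Real.exp (-5) ≤ 1/100 := by
      rw [show (-5:ℝ) = (5:ℕ) * (-1) by norm_num, Real.exp_nat_mul]
      have h := Real.exp_neg_one_lt_d9
      calc Real.exp (-1) ^ 5 ≤ (0.368:ℝ) ^ 5 := by gcongr; linarith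
        _ ≤ _ := by norm_num
    calc ∑ I ∈ S, (1:ℝ) ≤ ∑ I ∈ S, Real.exp (5 * (1/100000 * m)) * Real.exp (-5) ^ I.card := by
          apply sum_le_sum
          intro I hI
          simp only [hS, mem_filter, mem_univ, true_and] at hI
          rw [← Real.exp_nat_mul, ← Real.exp_add]
          apply Real.one_le_exp
          linarith [hI.2]
      _ ≤ ∑ I : Finset (Fin m), Real.exp (5 * (1/100000 * m)) * Real.exp (-5) ^ I.card := by
          apply sum_le_sum_of_subset_of_nonneg (subset_univ _)
          intros; positivity
      _ = Real.exp (5 * (1/100000 * m)) * (1 + Real.exp (-5)) ^ m := by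
          rw [← mul_sum, sum_pow_univ]
      _ ≤ Real.exp (5 * (1/100000 * m)) * (Real.exp (1/100)) ^ m := by
          gcongr
          have := Real.add_one_le_exp (1/100:ℝ)
          linarith
      _ ≤ _ := by
          rw [← Real.exp_nat_mul, ← Real.exp_add]
          apply Real.exp_le_exp.2
          have : (0:ℝ) ≤ m := by positivity
          linarith
  · have h3 : ∑ I ∈ S, z ^ I.card ≤ ∑ I ∈ (univ : Finset (Finset (Fin m))).erase ∅, z ^ I.card := by
      apply sum_le_sum_of_subset_of_nonneg
      · intro I hI
        simp only [hS, mem_filter, mem_univ, true_and] at hI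
        simp [hI.1.ne_empty]
      · intros; positivity
    have h4 := add_sum_erase (univ : Finset (Finset (Fin m))) (fun I => z ^ I.card) (mem_univ ∅)
    simp only [card_empty, pow_zero] at h4
    rw [sum_pow_univ] at h4
    linarith

lemma seq_of_sets {G : Type} [Fintype G] (m : ℕ) (E : Finset G → Prop) :
    m.factorial * (((univ : Finset G).powersetCard m).filter E).card ≤
      (univ.filter (fun x : Fin m → G => Function.Injective x ∧ E (univ.image x))).card := by
  have h1 := card_eq_sum_card_fiberwise (f := fun x : Fin m → G => univ.image x)
    (s := univ.filter (fun x : Fin m → G => Function.Injective x ∧ E (univ.image x)))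
    (t := ((univ : Finset G).powersetCard m).filter E) (by
      intro x hx
      simp only [coe_filter, mem_univ, true_and, Set.mem_ofPred_eq, mem_powersetCard, subset_univ] at hx ⊢
      refine ⟨?_, hx.2⟩
      rw [card_image_of_injective _ hx.1, card_univ, Fintype.card_fin])
  rw [h1, mul_comm, ← smul_eq_mul]
  apply card_nsmul_le_sum
  intro U hU
  simp only [mem_filter, mem_powersetCard, subset_univ, true_and] at hU
  have hc : Fintype.card (Fin m) = Fintype.card U := by simp [hU.1]
  have := Fintype.card_equiv (Fintype.equivOfCardEq hc)
  rw [Fintype.card_fin] at this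
  rw [← this, ← card_univ]
  apply card_le_card_of_injOn (fun (e : Fin m ≃ U) => fun i => (e i : G))
  · intro e _
    have him : univ.image (fun i => (e i : G)) = U := by
      ext g; simp only [mem_image, mem_univ, true_and]
      constructor
      · rintro ⟨i, rfl⟩; exact (e i).2
      · intro hg; exact ⟨e.symm ⟨g, hg⟩, by simp⟩
    simp only [coe_filter, mem_filter, mem_univ, true_and, Set.mem_ofPred_eq, him, and_true]
    exact ⟨Subtype.val_injective.comp e.injective, hU.2⟩
  · intro e _ e' _ h
    ext i
    exact congrFun h i

lemma prob_bound {G : Type} [AddCommGroup G] [Fintype G] [Nonempty G] (m : ℕ) (E : Finset G → Prop) (δ : ℝ)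
    (hm : 2 * (m:ℝ) ^ 2 ≤ Fintype.card G)
    (h : ((univ.filter (fun x : Fin m → G => Function.Injective x ∧ ¬ E (univ.image x))).card : ℝ) ≤
      (Fintype.card G : ℝ) ^ m * δ) :
    1 - 2 * δ ≤ uniformSubsetProb G m E := by
  unfold uniformSubsetProb
  set n := Fintype.card G with hn
  have hn0 : (0:ℝ) < n := by rw [hn]; exact_mod_cast Fintype.card_pos
  have hmn : m ≤ n := by
    have h1 : 2 * m ^ 2 ≤ n := by exact_mod_cast hm
    nlinarith
  have hdesc : (n:ℝ) ^ m / 2 ≤ n.descFactorial m := by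
    have h1 : (n + 1 - m) ^ m ≤ n.descFactorial m := Nat.pow_sub_le_descFactorial n m
    have h2 : (((n - m) ^ m : ℕ) : ℝ) ≤ n.descFactorial m := by
      exact_mod_cast (Nat.pow_le_pow_left (by omega) m).trans h1
    refine le_trans ?_ h2
    rw [Nat.cast_pow, Nat.cast_sub hmn]
    have h3 := one_add_mul_le_pow (a := -((m:ℝ)/n)) (by
      have : (m:ℝ)/n ≤ 1 := by rw [div_le_one hn0]; exact_mod_cast hmn
      linarith) m
    have h4 : (m:ℝ) * -((m:ℝ)/n) ≥ -(1/2) := by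
      have : (m:ℝ) * ((m:ℝ)/n) ≤ 1/2 := by
        rw [← mul_div_assoc, div_le_iff₀ hn0]; linarith
      linarith
    calc (n:ℝ)^m / 2 = n^m * (1/2) := by ring
      _ ≤ n^m * (1 + -((m:ℝ)/n))^m := by gcongr; linarith
      _ = _ := by rw [← mul_pow]; congr 1; field_simp; ring
  have hpc : ((univ : Finset G).powersetCard m).card = n.choose m := by
    rw [card_powersetCard, card_univ]
  have hcp : (0:ℝ) < n.choose m := by exact_mod_cast Nat.choose_pos hmn
  have hsplit := card_filter_add_card_filter_not (s := (univ : Finset G).powersetCard m) E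
  have hseq := seq_of_sets (G := G) m (fun U => ¬ E U)
  rw [hpc] at hsplit ⊢
  rw [le_div_iff₀ hcp]
  set b := (((univ : Finset G).powersetCard m).filter (fun U => ¬ E U)).card with hb
  have hsplit' : ((((univ : Finset G).powersetCard m).filter E).card : ℝ) + b = n.choose m := by exact_mod_cast hsplit
  have hseq' : (m.factorial : ℝ) * b ≤ (n:ℝ)^m * δ := by
    refine le_trans ?_ h
    have h9 : m.factorial * b ≤ (univ.filter (fun x : Fin m → G => Function.Injective x ∧ ¬ E (univ.image x))).card := by
      convert hseq
    exact_mod_cast h9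
  have hd : (n.descFactorial m : ℝ) = m.factorial * n.choose m := by
    exact_mod_cast Nat.descFactorial_eq_factorial_mul_choose n m
  have hfp : (0:ℝ) < m.factorial := by exact_mod_cast Nat.factorial_pos m
  have hδ : 0 ≤ δ := by
    by_contra hneg
    have : (n:ℝ)^m * δ < 0 := mul_neg_of_pos_of_neg (by positivity) (not_le.1 hneg)
    have : (0:ℝ) ≤ m.factorial * b := by positivity
    linarith
  have : (m.factorial : ℝ) * b ≤ m.factorial * (2 * δ * n.choose m) := by
    calc _ ≤ (n:ℝ)^m / 2 * (2 * δ) := by linarith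
      _ ≤ (n.descFactorial m) * (2 * δ) := by gcongr
      _ = _ := by rw [hd]; ring
  have := le_of_mul_le_mul_left this hfp
  linarith

lemma final_num (n L : ℝ) (m : ℕ) (hn : 1 ≤ n) (hL : L = Real.log n) (hm1 : 100 * L ≤ m - 1000)
   (hm3 : 1000000 * (n * L) ≤ (m:ℝ)^3) (hmn : 2 * (m:ℝ)^2 ≤ n) (hn2 : 100 ≤ n) :
   3 * Real.exp (-(1/4) * (m / 4 : ℕ)) * Real.exp (2 / 100 * m) +
          ((1 + Real.exp (-(((m / 4 : ℕ):ℝ) ^ 3 / (256 * n)))) ^ m - 1) ≤ 1 / (2 * n) := by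
  have hn0 : 0 < n := by linarith
  have hL0 : 0 ≤ L := hL ▸ Real.log_nonneg hn
  have hexpL : Real.exp (-L) = 1 / n := by rw [hL, Real.exp_neg, Real.exp_log hn0, one_div]
  have ht : (m:ℝ) / 5 ≤ (m/4 : ℕ) := by
    have : m ≤ 5 * (m/4) := by
      have : (1000:ℝ) ≤ m := by linarith
      have : 1000 ≤ m := by exact_mod_cast this
      omega
    have : (m:ℝ) ≤ 5 * (m/4 : ℕ) := by exact_mod_cast this
    linarith
  set t : ℝ := ((m/4 : ℕ):ℝ)
  have h1 : 3 * Real.exp (-(1/4) * t) * Real.exp (2 / 100 * m) ≤ 1 / (4 * n) := by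
    have : Real.exp (-(1/4) * t) * Real.exp (2 / 100 * m) ≤ Real.exp (-L) * Real.exp (-30) := by
      rw [← Real.exp_add, ← Real.exp_add]
      apply Real.exp_le_exp.2
      linarith
    have h30 : Real.exp (-30) ≤ 1/12 := by
      rw [Real.exp_neg, inv_le_comm₀ (Real.exp_pos _) (by norm_num)]
      have := Real.add_one_le_exp (30:ℝ)
      norm_num; linarith
    have : Real.exp (-L) * Real.exp (-30) ≤ 1/n * (1/12) := by rw [hexpL]; gcongr
    calc _ = 3 * (Real.exp (-(1/4) * t) * Real.exp (2 / 100 * m)) := by ring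
      _ ≤ 3 * (1/n * (1/12)) := by linarith
      _ = _ := by field_simp; norm_num
  have hz : Real.exp (-(t^3/(256*n))) ≤ 1 / n^4 := by
    have : (1/n^4 : ℝ) = Real.exp (-(4 * L)) := by
      rw [show -(4*L) = (4:ℕ) * (-L) by push_cast; ring, Real.exp_nat_mul, hexpL]; simp
    rw [this]
    apply Real.exp_le_exp.2
    apply neg_le_neg
    rw [le_div_iff₀ (by positivity)]
    have : ((m:ℝ)/5)^3 ≤ t^3 := by gcongr
    have : 0 ≤ n * L := by positivity
    have : ((m:ℝ)/5)^3 = (m:ℝ)^3 / 125 := by ring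
    nlinarith
  set z := Real.exp (-(t^3/(256*n)))
  have hz0 : 0 < z := Real.exp_pos _
  have hmn' : (m:ℝ) ≤ n := by
    have : (1000:ℝ) ≤ m := by linarith
    nlinarith
  have hmz : m * z ≤ 1 / n^3 := by
    calc m * z ≤ n * (1/n^4) := by gcongr
      _ = _ := by field_simp
  have hn3 : 1/n^3 ≤ 1/(8*n) := by
    apply one_div_le_one_div_of_le (by positivity)
    nlinarith [mul_pos hn0 hn0]
  have h8 : 1/(8*n) ≤ 1/8 := by
    apply one_div_le_one_div_of_le (by norm_num); linarith
  have h2 : (1+z)^m - 1 ≤ 2 * (m * z) := by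
    have a1 : (1+z)^m ≤ Real.exp (m * z) := by
      rw [Real.exp_nat_mul]; gcongr; linarith [Real.add_one_le_exp z]
    have a2 : |Real.exp (m*z) - 1| ≤ 2 * |m*z| := Real.abs_exp_sub_one_le (by
      rw [abs_of_nonneg (by positivity)]; linarith)
    rw [abs_of_nonneg (show 0 ≤ (m:ℝ)*z by positivity)] at a2
    linarith [le_abs_self (Real.exp (m*z) - 1)]
  have : 1/(4*n) + 2 * (1/(8*n)) = 1/(2*n) := by field_simp; norm_num
  linarith

lemma asymp : ∃ n₀ : ℕ, ∀ n : ℕ, n₀ ≤ n → 100 ≤ n ∧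
    100 * Real.log n ≤ (⌈100 * ((n : ℝ) * Real.log n) ^ ((1 : ℝ) / 3)⌉₊ : ℝ) - 1000 ∧
    1000000 * ((n:ℝ) * Real.log n) ≤ (⌈100 * ((n : ℝ) * Real.log n) ^ ((1 : ℝ) / 3)⌉₊ : ℝ)^3 ∧
    2 * (⌈100 * ((n : ℝ) * Real.log n) ^ ((1 : ℝ) / 3)⌉₊ : ℝ)^2 ≤ n := by
  have hlog := (isLittleO_log_rpow_atTop (show (0:ℝ) < 1/10 by norm_num)).bound (show (0:ℝ) < 1 by norm_num)
  have hbig1 := (tendsto_rpow_atTop (show (0:ℝ) < 7/30 by norm_num)).eventually_ge_atTop 1100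
  have hbig2 := (tendsto_rpow_atTop (show (0:ℝ) < 4/15 by norm_num)).eventually_ge_atTop 100000
  have := (hlog.and (hbig1.and (hbig2.and (Filter.eventually_ge_atTop (100:ℝ)))))
  have := tendsto_natCast_atTop_atTop (R := ℝ) |>.eventually this
  obtain ⟨n₀, h⟩ := Filter.eventually_atTop.1 this
  refine ⟨n₀, fun n hn => ?_⟩
  obtain ⟨hl, hb1, hb2, h100⟩ := h n hn
  set x : ℝ := (n : ℝ) with hx
  have hx0 : 0 < x := by linarith
  have hL1 : 1 ≤ Real.log x := by
    rw [Real.le_log_iff_exp_le hx0]; linarith [Real.exp_one_lt_d9]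
  set L := Real.log x with hL
  rw [one_mul, Real.norm_of_nonneg (by linarith), Real.norm_of_nonneg (by positivity)] at hl
  set r := (x * L) ^ ((1:ℝ)/3) with hr
  have hr0 : 0 ≤ r := by positivity
  have hceil : 100 * r ≤ ⌈100 * r⌉₊ := Nat.le_ceil _
  have hceil2 : (⌈100 * r⌉₊ : ℝ) < 100 * r + 1 := Nat.ceil_lt_add_one (by positivity)
  have hr3 : r ^ 3 = x * L := by
    rw [hr, ← Real.rpow_natCast, ← Real.rpow_mul (by positivity)]; norm_num
  have hrlow : x ^ ((1:ℝ)/3) ≤ r := by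
    apply Real.rpow_le_rpow hx0.le _ (by norm_num); nlinarith
  have h13 : x ^ ((1:ℝ)/3) = x ^ ((7:ℝ)/30) * x ^ ((1:ℝ)/10) := by
    rw [← Real.rpow_add hx0]; norm_num
  have h10 : 1 ≤ x ^ ((1:ℝ)/10) := by linarith
  have hrL : 1100 * L ≤ r := by
    calc 1100 * L ≤ x ^ ((7:ℝ)/30) * x ^ ((1:ℝ)/10) := by gcongr
      _ ≤ r := by rw [← h13]; exact hrlow
  have hrup : r ≤ x ^ ((11:ℝ)/30) := by
    have : x ^ ((11:ℝ)/30) = (x * x^((1:ℝ)/10))^((1:ℝ)/3) := by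
      rw [Real.mul_rpow hx0.le (by positivity), ← Real.rpow_mul hx0.le, ← Real.rpow_add hx0]; norm_num
    rw [this]
    apply Real.rpow_le_rpow (by positivity) _ (by norm_num)
    gcongr
  have hr2 : 100000 * r^2 ≤ x := by
    calc 100000 * r^2 ≤ x ^ ((4:ℝ)/15) * (x ^ ((11:ℝ)/30))^2 := by gcongr
      _ = x := by
        rw [← Real.rpow_natCast, ← Real.rpow_mul hx0.le, ← Real.rpow_add hx0]; norm_num
  refine ⟨by rw [hx] at h100; exact_mod_cast h100, by linarith, ?_, ?_⟩
  · calc 1000000 * (x * L) = (100 * r)^3 := by rw [← hr3]; ring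
      _ ≤ _ := by gcongr
  · calc 2 * (⌈100 * r⌉₊ : ℝ)^2 ≤ 2 * (101 * r)^2 := by gcongr; linarith
      _ ≤ x := by nlinarith [sq_nonneg r]

theorem random_set_additively_connected :
    ∃ C : ℝ, 0 < C ∧ ∃ n₀ : ℕ,
      ∀ (G : Type) [AddCommGroup G] [Fintype G], n₀ ≤ Fintype.card G →
        1 - 1 / (Fintype.card G : ℝ) ≤
          uniformSubsetProb G
            (⌈C * ((Fintype.card G : ℝ) * Real.log (Fintype.card G)) ^ ((1 : ℝ) / 3)⌉₊)
            (fun U => AddConnected (1 / 100000 : ℝ) U) := by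
  obtain ⟨n₀, h⟩ := asymp
  refine ⟨100, by norm_num, n₀, ?_⟩
  intro G _ _ hG
  obtain ⟨h100, h1, h3, h2⟩ := h _ hG
  have hne : Nonempty G := ⟨0⟩
  have hn : (100:ℝ) ≤ Fintype.card G := by exact_mod_cast h100
  have hL0 : 0 ≤ Real.log (Fintype.card G) := Real.log_nonneg (by linarith)
  set m := ⌈100 * ((Fintype.card G : ℝ) * Real.log (Fintype.card G)) ^ ((1 : ℝ) / 3)⌉₊ with hm
  have hm1000 : (1000:ℝ) ≤ m := by linarith
  have hm1000' : 1000 ≤ m := by exact_mod_cast hm1000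
  have hb := bad_seq (G := G) m (m/4) (by omega) (by
    have : ((m/4 : ℕ) : ℝ) ≤ m / 4 := Nat.cast_div_le
    linarith)
  have hf := final_num (Fintype.card G) _ m (by linarith) rfl h1 h3 h2 hn
  have hp := prob_bound m (fun U => AddConnected (1 / 100000 : ℝ) U) (1 / (2 * Fintype.card G)) h2
    (hb.trans (by gcongr))
  refine le_trans (le_of_eq ?_) hp
  field_simp

end
end
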